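/- arXiv:2310.11387 — 2 statements merged into one kernel-verified Lean document; each statement's English description precedes it below -/
import Mathlib

section
/- Let n = |𝓛| and assume T(𝓛) acts transitively on 𝓛. If T(𝓛) contains a nontrivial cycle whose length is at most n − 3 (equivalently, a nontrivial cycle with at least three fixed points), then T(𝓛) contains the alternating group on 𝓛. -/
open scoped symmDiff

namespace TogglePaper

variable {E : Type*} [DecidableEq E]

/-- The toggle `τ_e` on the collection `L` of subsets of the ground set. -/
def toggle (L : Finset (Finset E)) (e : E) : Equiv.Perm {A : Finset E // A ∈ L} :=
  Function.Involutive.toPerm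
    (fun X => if h : X.1 ∆ ({e} : Finset E) ∈ L then ⟨X.1 ∆ ({e} : Finset E), h⟩ else X)
    (by
      intro X
      by_cases h : X.1 ∆ ({e} : Finset E) ∈ L
      · have h2 : (X.1 ∆ ({e} : Finset E)) ∆ ({e} : Finset E) = X.1 :=
          symmDiff_symmDiff_cancel_right _ _
        simp only [dif_pos h, h2]
        simp [h2, X.2]
      · simp [h])

/-- The generalized toggle group `T(L)`. -/
def toggleGroup (L : Finset (Finset E)) : Subgroup (Equiv.Perm {A : Finset E // A ∈ L}) :=
  Subgroup.closure (Set.range (toggle L))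

/-- `T(L)` acts transitively on `L`. -/
def IsTransitive (L : Finset (Finset E)) : Prop :=
  ∀ A B : {A : Finset E // A ∈ L}, ∃ g ∈ toggleGroup L, g A = B

/-- `B` is a block for the action of `T(L)` on `L`. -/
def IsBlock (L : Finset (Finset E)) (B : Finset {A : Finset E // A ∈ L}) : Prop :=
  ∀ g ∈ toggleGroup L, Finset.image g B = B ∨ Disjoint (Finset.image g B) B

/-- `Blocks` is a block system for `T(L)`: a partition of `L` into nonempty blocks
that is permuted by every element of `T(L)`. -/
def IsBlockSystem (L : Finset (Finset E))
    (Blocks : Finset (Finset {A : Finset E // A ∈ L})) : Prop :=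
  (∀ B ∈ Blocks, B.Nonempty) ∧
  (∀ A : {A : Finset E // A ∈ L}, ∃! B : Finset {A : Finset E // A ∈ L},
      B ∈ Blocks ∧ A ∈ B) ∧
  (∀ g ∈ toggleGroup L, ∀ B ∈ Blocks, Finset.image g B ∈ Blocks)

/-- An element `g` of `T(L)` is type 2 (with respect to a fixed block system `Blocks`)
if it maps each block to itself; it is type 1 otherwise. -/
def IsType2 (L : Finset (Finset E)) (Blocks : Finset (Finset {A : Finset E // A ∈ L}))
    (g : Equiv.Perm {A : Finset E // A ∈ L}) : Prop :=
  ∀ B ∈ Blocks, Finset.image g B = B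

/-- The action of `T(L)` on `L` is primitive: it is transitive and the only blocks
are the singletons, the empty set and the whole set. -/
def IsPrimitive (L : Finset (Finset E)) : Prop :=
  IsTransitive L ∧
    ∀ B : Finset {A : Finset E // A ∈ L}, IsBlock L B → B.card ≤ 1 ∨ B = Finset.univ

/-- `T(L)` contains a long cycle, i.e. a cycle whose support is all of `L`. -/
def HasLongCycle (L : Finset (Finset E)) : Prop :=
  ∃ g ∈ toggleGroup L, g.IsCycle ∧ g.support = Finset.univ

section PermutationGroups

open MulAction Equiv

section Counting

variable {α : Type*} [Fintype α] [DecidableEq α]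

/-- In a `4`-transitive group, the number of elements with prescribed images of four points does
not depend on the points. -/
theorem exists_card_filter_apply_eq (G : Subgroup (Perm α)) [DecidablePred (· ∈ G)]
    [hG : IsMultiplyPretransitive G α 4] (hα : 4 ≤ Fintype.card α) :
    ∃ κ : ℕ, 0 < κ ∧ ∀ v u : Fin 4 ↪ α,
      (Finset.univ.filter fun h : G => ∀ i, (h : Perm α) (v i) = u i).card = κ := by
  obtain ⟨e⟩ : Nonempty (Fin 4 ↪ α) :=
    Function.Embedding.nonempty_of_card_le (by simpa using hα)
  have key : ∀ v : Fin 4 ↪ α, ∃ a : G, ∀ i, (a : Perm α) (v i) = e i := fun v => by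
    obtain ⟨a, ha⟩ := exists_smul_eq G v e
    exact ⟨a, fun i => by rw [← ha]; rfl⟩
  refine ⟨(Finset.univ.filter fun h : G => ∀ i, (h : Perm α) (e i) = e i).card,
    Finset.card_pos.2 ⟨1, by simp⟩, fun v u => ?_⟩
  obtain ⟨a, ha⟩ := key v
  obtain ⟨b, hb⟩ := key u
  refine Finset.card_bij' (fun h _ => b * h * a⁻¹) (fun h _ => b⁻¹ * h * a) ?_ ?_ ?_ ?_
  · intro h hh
    simp only [Finset.mem_filter, Finset.mem_univ, true_and] at hh ⊢
    intro i
    simp [← ha, hh, hb]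
  · intro h hh
    simp only [Finset.mem_filter, Finset.mem_univ, true_and] at hh ⊢
    intro i
    simp [ha, hh, Equiv.symm_apply_eq, hb]
  · intros; group
  · intros; group

/-- The embedding of `Fin 4` listing four distinct points. -/
def fourPoints (v : α × α × α × α) (h : [v.1, v.2.1, v.2.2.1, v.2.2.2].Nodup) : Fin 4 ↪ α where
  toFun := ![v.1, v.2.1, v.2.2.1, v.2.2.2]
  inj' := by
    simp only [List.nodup_cons, List.mem_cons, not_or] at h
    intro i j hij
    fin_cases i <;> fin_cases j <;> simp_all

/-- The four points of a tuple are distinct. -/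
def Distinct4 (v : α × α × α × α) : Prop := [v.1, v.2.1, v.2.2.1, v.2.2.2].Nodup

/-- Apply a permutation to the four points of a tuple. -/
def map4 (h : Perm α) (v : α × α × α × α) : α × α × α × α :=
  (h v.1, h v.2.1, h v.2.2.1, h v.2.2.2)

omit [Fintype α] [DecidableEq α] in
theorem Distinct4.map4 {v : α × α × α × α} (hv : Distinct4 v) (h : Perm α) :
    Distinct4 (map4 h v) := by
  have := List.Nodup.map h.injective hv
  simpa [Distinct4, TogglePaper.map4] using this

theorem exists_card_filter_map4 (G : Subgroup (Perm α)) [DecidablePred (· ∈ G)]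
    [hG : IsMultiplyPretransitive G α 4] (hα : 4 ≤ Fintype.card α) :
    ∃ κ : ℕ, 0 < κ ∧
      (∀ v : α × α × α × α, Distinct4 v → ∀ T : Finset (α × α × α × α),
        (Finset.univ.filter fun h : G => map4 h v ∈ T).card ≤ T.card * κ) ∧
      (∀ v : α × α × α × α, Distinct4 v → ∀ T : Finset (α × α × α × α), (∀ u ∈ T, Distinct4 u) →
        (Finset.univ.filter fun h : G => map4 h v ∈ T).card = T.card * κ) := by
  obtain ⟨κ, hκ, H⟩ := exists_card_filter_apply_eq G hα
  have key : ∀ v, Distinct4 v → ∀ T : Finset (α × α × α × α), (∀ u ∈ T, Distinct4 u) →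
      (Finset.univ.filter fun h : G => map4 h v ∈ T).card = T.card * κ := by
    intro v hv T hT
    rw [Finset.card_eq_sum_card_fiberwise (t := T) (f := fun h : G => map4 h v)
      (fun h hh => by simpa using hh), Finset.sum_const_nat (m := κ)]
    intro u hu
    rw [← H (fourPoints v hv) (fourPoints u (hT u hu))]
    congr 1
    ext h
    simp only [Finset.mem_filter, Finset.mem_univ, true_and]
    constructor
    · rintro ⟨-, rfl⟩ i
      fin_cases i <;> rfl
    · intro hh
      have : map4 h v = u :=
        Prod.ext (hh 0) (Prod.ext (hh 1) (Prod.ext (hh 2) (hh 3)))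
      exact ⟨this ▸ hu, this⟩
  refine ⟨κ, hκ, fun v hv T => ?_, key⟩
  classical
  calc _ = (Finset.univ.filter fun h : G => map4 h v ∈ T.filter Distinct4).card := by
        congr 1
        ext h
        simp [hv.map4]
    _ = (T.filter Distinct4).card * κ := key v hv _ (by simp)
    _ ≤ _ := Nat.mul_le_mul_right _ (Finset.card_filter_le _ _)

end Counting

section TupleCounting

variable {α : Type*} [Fintype α] [DecidableEq α]

theorem card_filter_fiber {β γ : Type*} [Fintype β] [Fintype γ] [DecidableEq β] [DecidableEq γ]
    (U : Finset β) (F : β → Finset γ) (k : ℕ) (hF : ∀ u ∈ U, (F u).card = k) :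
    (Finset.univ.filter fun p : β × γ => p.1 ∈ U ∧ p.2 ∈ F p.1).card = U.card * k := by
  rw [Finset.card_eq_sum_card_fiberwise (t := U) (f := Prod.fst)
    (fun p hp => by simp at hp ⊢; exact hp.1), Finset.sum_const_nat]
  intro u hu
  rw [← hF u hu]
  refine Finset.card_bij' (fun p _ => p.2) (fun c _ => (u, c)) ?_ ?_ ?_ ?_
  · rintro ⟨a, b⟩ hp
    simp only [Finset.mem_filter, Finset.mem_univ, true_and] at hp
    obtain ⟨⟨-, h⟩, rfl⟩ := hp
    exact h
  · intro c hc
    simp [hu, hc]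
  · rintro ⟨a, b⟩ hp
    simp only [Finset.mem_filter, Finset.mem_univ, true_and] at hp
    obtain ⟨-, rfl⟩ := hp
    rfl
  · intros; rfl

/-- Tuples `(a, b, c, d)` with `a, c` distinct in `A`, with `b ∈ B` and `d ∈ F b`. -/
def linkedTuples (A B : Finset α) (F : α → Finset α) : Finset (α × α × α × α) :=
  Finset.univ.filter fun p => p.1 ∈ A ∧ p.2 ∈ Finset.univ.filter fun q : α × α × α =>
    q.1 ∈ B ∧ q.2 ∈ Finset.univ.filter fun r : α × α => r.1 ∈ A.erase p.1 ∧ r.2 ∈ F q.1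

theorem card_linkedTuples (A B : Finset α) (F : α → Finset α) (k : ℕ)
    (hF : ∀ b ∈ B, (F b).card = k) :
    (linkedTuples A B F).card = A.card * (B.card * ((A.card - 1) * k)) := by
  refine card_filter_fiber _ (fun a => Finset.univ.filter fun q : α × α × α =>
    q.1 ∈ B ∧ q.2 ∈ Finset.univ.filter fun r : α × α => r.1 ∈ A.erase a ∧ r.2 ∈ F q.1) _
    fun a ha => ?_
  refine card_filter_fiber _ (fun b => Finset.univ.filter fun r : α × α =>
    r.1 ∈ A.erase a ∧ r.2 ∈ F b) _ fun b hb => ?_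
  rw [card_filter_fiber (A.erase a) (fun _ => F b) k fun _ _ => hF b hb,
    Finset.card_erase_of_mem ha]

/-- Tuples of four distinct points whose first two entries lie in `A` and `B`. -/
def basedTuples (A B : Finset α) : Finset (α × α × α × α) :=
  Finset.univ.filter fun p => p.1 ∈ A ∧ p.2 ∈ Finset.univ.filter fun q : α × α × α =>
    q.1 ∈ B ∧ q.2 ∈ Finset.univ.filter fun r : α × α =>
      r.1 ∈ ({p.1, q.1} : Finset α)ᶜ ∧ r.2 ∈ ({p.1, q.1, r.1} : Finset α)ᶜ

theorem card_basedTuples (A B : Finset α) (hAB : Disjoint A B) :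
    (basedTuples A B).card =
      A.card * (B.card * ((Fintype.card α - 2) * (Fintype.card α - 3))) := by
  refine card_filter_fiber _ (fun a => Finset.univ.filter fun q : α × α × α =>
    q.1 ∈ B ∧ q.2 ∈ Finset.univ.filter fun r : α × α =>
      r.1 ∈ ({a, q.1} : Finset α)ᶜ ∧ r.2 ∈ ({a, q.1, r.1} : Finset α)ᶜ) _ fun a ha => ?_
  refine card_filter_fiber _ (fun b => Finset.univ.filter fun r : α × α =>
      r.1 ∈ ({a, b} : Finset α)ᶜ ∧ r.2 ∈ ({a, b, r.1} : Finset α)ᶜ) _ fun b hb => ?_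
  have hab : a ≠ b := Finset.disjoint_iff_ne.1 hAB a ha b hb
  rw [card_filter_fiber ({a, b} : Finset α)ᶜ (fun c => ({a, b, c} : Finset α)ᶜ)
    (Fintype.card α - 3), Finset.card_compl, Finset.card_pair hab]
  intro c hc
  have hc' : c ≠ a ∧ c ≠ b := by simpa using hc
  rw [Finset.card_compl, Finset.card_eq_three.2 ⟨a, b, c, hab, hc'.1.symm, hc'.2.symm, rfl⟩]

theorem distinct4_of_mem_basedTuples {A B : Finset α} (hAB : Disjoint A B) {p : α × α × α × α}
    (hp : p ∈ basedTuples A B) : Distinct4 p := by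
  simp only [basedTuples, Finset.mem_filter, Finset.mem_univ, true_and, Finset.mem_compl,
    Finset.mem_insert, Finset.mem_singleton, not_or] at hp
  obtain ⟨ha, hb, ⟨h1, h2⟩, h3, h4, h5⟩ := hp
  have hab := Finset.disjoint_iff_ne.1 hAB _ ha _ hb
  simp only [Distinct4, List.nodup_cons, List.mem_cons, not_or]
  grind

variable (G : Subgroup (Perm α)) [DecidablePred (· ∈ G)]

/-- The set of `(h, v)` with `h v ∈ A` and `h (g v) ∈ B`, where `v` is moved by `g`. -/
def crossings (g : Perm α) (A B : Finset α) : Finset (α × G) :=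
  Finset.univ.filter fun p => p.1 ∈ g.support ∧
    p.2 ∈ Finset.univ.filter fun h : G => (h : Perm α) p.1 ∈ A ∧ (h : Perm α) (g p.1) ∈ B

/-- The points `w` other than `v` with `h w ∈ A` and `h (g w) ∈ F (h (g v))`. -/
def otherCrossings (g : Perm α) (A : Finset α) (F : α → Finset α) (p : α × G) : Finset α :=
  Finset.univ.filter fun w => w ≠ p.1 ∧ (p.2 : Perm α) w ∈ A ∧
    (p.2 : Perm α) (g w) ∈ F ((p.2 : Perm α) (g p.1))

theorem exists_crossing_counts [hG : IsMultiplyPretransitive G α 4] (hα : 4 ≤ Fintype.card α) :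
    ∃ κ : ℕ, 0 < κ ∧ ∀ (g : Perm α) (A B : Finset α), Disjoint A B →
      g.support.card * (A.card * (B.card * ((Fintype.card α - 2) * (Fintype.card α - 3)))) * κ ≤
        (crossings G g A B).card ∧
      ∀ (F : α → Finset α) (k : ℕ), (∀ b ∈ B, F b ⊆ B) →
        (∀ b ∈ B, (F b).card = k) →
        ∑ p ∈ crossings G g A B, (otherCrossings G g A F p).card ≤
          g.support.card * (g.support.card - 2) *
            (A.card * (B.card * ((A.card - 1) * k))) * κ := by
  obtain ⟨κ, hκ, hle, heq⟩ := exists_card_filter_map4 G hα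
  refine ⟨κ, hκ, fun g A B hAB => ⟨?_, fun F k hFB hk => ?_⟩⟩
  · have hfib : ∀ v ∈ g.support,
        (A.card * (B.card * ((Fintype.card α - 2) * (Fintype.card α - 3)))) * κ ≤
        (Finset.univ.filter fun h : G => (h : Perm α) v ∈ A ∧ (h : Perm α) (g v) ∈ B).card := by
      intro v hv
      have hv' : g v ≠ v := by simpa using hv
      obtain ⟨c, hc⟩ : ∃ c, c ∉ ({v, g v} : Finset α) := by
        by_contra! h
        have := Finset.card_le_card (fun x _ => h x : (Finset.univ : Finset α) ⊆ _)
        have h2 := Finset.card_le_two (a := v) (b := g v)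
        rw [Finset.card_univ] at this
        omega
      obtain ⟨d, hd⟩ : ∃ d, d ∉ ({v, g v, c} : Finset α) := by
        by_contra! h
        have := Finset.card_le_card (fun x _ => h x : (Finset.univ : Finset α) ⊆ _)
        have h2 := Finset.card_le_three (a := v) (b := g v) (c := c)
        rw [Finset.card_univ] at this
        omega
      have hdist : Distinct4 (v, g v, c, d) := by
        simp only [Distinct4, List.nodup_cons, List.mem_cons, not_or]
        simp at hc hd
        grind
      rw [← card_basedTuples A B hAB,
        ← heq _ hdist _ fun u hu => distinct4_of_mem_basedTuples hAB hu]
      refine Finset.card_le_card fun h hh => ?_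
      simp only [basedTuples, map4, Finset.mem_filter, Finset.mem_univ, true_and] at hh ⊢
      exact ⟨hh.1, hh.2.1⟩
    rw [mul_assoc, ← smul_eq_mul, ← Finset.sum_const]
    refine (Finset.sum_le_sum hfib).trans ?_
    rw [crossings, Finset.card_eq_sum_card_fiberwise (t := g.support) (f := Prod.fst)
      (fun p hp => by simp at hp ⊢; exact hp.1)]
    refine Finset.sum_le_sum fun v hv => ?_
    refine Finset.card_le_card_of_injOn (fun h => (v, h)) ?_ (fun _ _ _ _ h => (Prod.ext_iff.1 h).2)
    intro h hh
    simp only [Finset.coe_filter, Finset.mem_univ, true_and, Set.mem_ofPred_eq,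
      Finset.mem_filter] at hh ⊢
    exact ⟨⟨hv, hh⟩, trivial⟩
  · have hfib : ∀ v ∈ g.support, ∀ w ∈ g.support \ {v, g v},
        (Finset.univ.filter fun h : G => (h : Perm α) v ∈ A ∧ (h : Perm α) (g v) ∈ B ∧
          (h : Perm α) w ∈ A ∧ (h : Perm α) (g w) ∈ F ((h : Perm α) (g v))).card ≤
        (A.card * (B.card * ((A.card - 1) * k))) * κ := by
      intro v hv w hw
      have hv' : g v ≠ v := by simpa using hv
      simp only [Finset.mem_sdiff, Perm.mem_support, Finset.mem_insert, Finset.mem_singleton,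
        not_or] at hw
      obtain ⟨hw', hwv, hwg⟩ := hw
      by_cases hgw : g w = v
      · rw [Finset.filter_eq_empty_iff.2]
        · simp
        rintro h - ⟨h1, h2, h3, h4⟩
        rw [hgw] at h4
        exact Finset.disjoint_left.1 hAB h1 (hFB _ h2 h4)
      have hdist : Distinct4 (v, g v, w, g w) := by
        have : g v ≠ g w := fun h => hwv (g.injective h).symm
        simp only [Distinct4, List.nodup_cons, List.mem_cons, not_or]
        grind
      rw [← card_linkedTuples A B F k hk]
      refine le_trans (Finset.card_le_card fun h hh => ?_) (hle _ hdist _)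
      simp only [linkedTuples, map4, Finset.mem_filter, Finset.mem_univ, true_and,
        Finset.mem_erase] at hh ⊢
      exact ⟨hh.1, hh.2.1, ⟨(h : Perm α).injective.ne hwv, hh.2.2.1⟩, hh.2.2.2⟩
    have hstep : ∑ p ∈ crossings G g A B, (otherCrossings G g A F p).card ≤
        ∑ v ∈ g.support, ∑ w ∈ g.support \ {v, g v},
        (Finset.univ.filter fun h : G => (h : Perm α) v ∈ A ∧ (h : Perm α) (g v) ∈ B ∧
          (h : Perm α) w ∈ A ∧ (h : Perm α) (g w) ∈ F ((h : Perm α) (g v))).card := by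
      simp only [← Finset.card_sigma]
      refine Finset.card_le_card_of_injOn
        (fun q => ⟨q.1.1, q.2, q.1.2⟩) ?_ ?_
      · rintro ⟨⟨v, h⟩, w⟩ hq
        simp only [crossings, otherCrossings, Finset.coe_sigma, Set.mem_sigma_iff, Finset.mem_coe,
          Finset.mem_filter, Finset.mem_univ, true_and, Finset.mem_sdiff, Finset.mem_insert,
          Finset.mem_singleton, not_or] at hq ⊢
        obtain ⟨⟨hv, h1, h2⟩, hwv, h3, h4⟩ := hq
        refine ⟨hv, ⟨?_, hwv, ?_⟩, h1, h2, h3, h4⟩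
        · rw [Perm.mem_support]
          intro hw
          rw [hw] at h4
          exact Finset.disjoint_left.1 hAB h3 (hFB _ h2 h4)
        · rintro rfl
          exact Finset.disjoint_left.1 hAB h3 h2
      · rintro ⟨⟨v, h⟩, w⟩ - ⟨⟨v', h'⟩, w'⟩ - hq
        cases hq
        rfl
    refine hstep.trans ?_
    calc _ ≤ ∑ v ∈ g.support,
            (g.support.card - 2) * ((A.card * (B.card * ((A.card - 1) * k))) * κ) := by
          refine Finset.sum_le_sum fun v hv => ?_
          refine (Finset.sum_le_sum (hfib v hv)).trans (le_of_eq ?_)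
          have hv' : g v ≠ v := by simpa using hv
          rw [Finset.sum_const, smul_eq_mul, Finset.card_sdiff_of_subset, Finset.card_pair hv'.symm]
          intro x hx
          rw [Finset.mem_insert, Finset.mem_singleton] at hx
          rcases hx with rfl | rfl
          · exact hv
          · exact Perm.apply_mem_support.2 hv
      _ = _ := by rw [Finset.sum_const, smul_eq_mul]; ring

end TupleCounting

section Commutators

variable {α : Type*} [Fintype α] [DecidableEq α]

theorem support_commutator_subset (y c : Perm α) :
    (y * c * y⁻¹ * c⁻¹).support ⊆ (c.support ∩ y.support) ∪ (c.support ∩ y.support).image y ∪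
      (c.support ∩ y.support).image c := by
  intro z hz
  by_contra hn
  simp only [Finset.mem_union, Finset.mem_image, Finset.mem_inter, not_or, not_exists, not_and,
    Perm.mem_support] at hn hz
  obtain ⟨⟨h1, h2⟩, h3⟩ := hn
  obtain ⟨u, rfl⟩ := c.surjective z
  obtain ⟨w, hw⟩ := y.surjective u
  apply hz
  simp only [Perm.mul_apply, Perm.inv_def, Equiv.symm_apply_apply, ← hw]
  rw [hw]
  by_cases hyu : y u = u
  · have hwu : w = u := y.injective (hw.trans hyu.symm)
    rw [hwu]
    by_contra h
    refine h1 (fun hcu => ?_) h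
    have := c.injective hcu
    rw [this, hyu] at h
    exact h rfl
  · have hcu : c u = u := by
      by_contra h
      exact h3 u ⟨h, hyu⟩ rfl
    rw [hcu] at h2 ⊢
    have hcw : c w = w := by
      by_contra h
      refine h2 w ⟨h, fun hyw => hyu ?_⟩ hw
      rw [hyw] at hw
      rw [← hw, hyw]
    rw [hcw, hw]

theorem card_support_commutator_le (y c : Perm α) :
    (y * c * y⁻¹ * c⁻¹).support.card ≤ 3 * (c.support ∩ y.support).card := by
  have h1 := Finset.card_le_card (support_commutator_subset y c)
  have h2 := Finset.card_union_le (c.support ∩ y.support ∪ (c.support ∩ y.support).image y)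
    ((c.support ∩ y.support).image c)
  have h3 := Finset.card_union_le (c.support ∩ y.support) ((c.support ∩ y.support).image y)
  have h4 := Finset.card_image_le (s := c.support ∩ y.support) (f := y)
  have h5 := Finset.card_image_le (s := c.support ∩ y.support) (f := c)
  omega

theorem card_support_commutator_lt (y c : Perm α) {z : α} (hz : z ∈ c.support ∩ y.support)
    (hyz : y z ∈ c.support ∩ y.support) :
    (y * c * y⁻¹ * c⁻¹).support.card < 3 * (c.support ∩ y.support).card := by
  have h1 := Finset.card_le_card (support_commutator_subset y c)
  have h2 := Finset.card_union_le (c.support ∩ y.support ∪ (c.support ∩ y.support).image y)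
    ((c.support ∩ y.support).image c)
  have h3 := Finset.card_union_add_card_inter (c.support ∩ y.support)
    ((c.support ∩ y.support).image y)
  have h4 := Finset.card_image_le (s := c.support ∩ y.support) (f := y)
  have h5 := Finset.card_image_le (s := c.support ∩ y.support) (f := c)
  have h6 : 0 < (c.support ∩ y.support ∩ (c.support ∩ y.support).image y).card :=
    Finset.card_pos.2 ⟨y z, Finset.mem_inter.2 ⟨hyz, Finset.mem_image_of_mem _ hz⟩⟩
  omega

theorem prime_dvd_card_of_invariant {σ : Perm α} {p : ℕ} (hp : p.Prime) (hσ : σ ^ p = 1)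
    {S : Finset α} (hS : S ⊆ σ.support) (hinv : ∀ z ∈ S, σ z ∈ S) : p ∣ S.card := by
  have := Fact.mk hp
  have hiff : ∀ z, σ z ∈ S ↔ z ∈ S := by
    intro z
    refine ⟨fun hz => ?_, hinv z⟩
    have himg : S.image σ = S :=
      Finset.eq_of_subset_of_card_le (Finset.image_subset_iff.2 hinv)
        (Finset.card_image_of_injective S σ.injective).ge
    rw [← himg, Finset.mem_image] at hz
    obtain ⟨w, hw, h⟩ := hz
    rwa [← σ.injective h]
  have hpow : (σ.subtypePerm hiff) ^ p ^ 1 = 1 := by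
    rw [pow_one, Perm.subtypePerm_pow]
    ext z
    simp [hσ]
  have hmod := Perm.card_compl_support_modEq hpow
  have : (σ.subtypePerm hiff).supportᶜ = ∅ := by
    rw [Finset.compl_eq_empty_iff, Finset.eq_univ_iff_forall]
    intro z
    rw [Perm.mem_support]
    intro h
    exact Perm.mem_support.1 (hS z.2) (congrArg Subtype.val h)
  rw [this, Finset.card_empty, Fintype.card_coe] at hmod
  exact (Nat.modEq_zero_iff_dvd.1 hmod.symm)

theorem six_le_of_dvd {p q s : ℕ} (hp : p.Prime) (hq : q.Prime) (hpq : p ≠ q) (hps : p ∣ s)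
    (hqs : q ∣ s) (hs : 0 < s) : 6 ≤ s := by
  have h1 := Nat.le_of_dvd hs (((Nat.coprime_primes hp hq).2 hpq).mul_dvd_of_dvd_of_dvd hps hqs)
  have h2 := hp.two_le
  have h3 := hq.two_le
  rcases Nat.lt_or_gt_of_ne hpq with h | h <;> nlinarith

variable (G : Subgroup (Perm α)) [DecidablePred (· ∈ G)]

/-- The dichotomy for the commutator of `y` with the conjugate of `x` by `h * g * h⁻¹`. -/
theorem crossing_dichotomy {x y g : Perm α} {p q m : ℕ} (hx : x ∈ G) (hy : y ∈ G) (hg : g ∈ G)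
    (hp : p.Prime) (hq : q.Prime) (hpq : p ≠ q) (hxp : x ^ p = 1) (hyq : y ^ q = 1)
    (hmin : ∀ k ∈ G, k ≠ 1 → m ≤ k.support.card)
    (P : α × G) (hP : P ∈ crossings G g x.support y.support) :
    m ≤ 3 * (otherCrossings G g x.support (fun b => y.support \ {b, y b}) P).card + 3 ∨
    (1 ≤ (otherCrossings G g x.support (fun b => {y b}) P).card ∧
      (m ≤ 3 * (otherCrossings G g x.support (fun b => y.support \ {b, y b}) P).card + 5 ∨
        4 ≤ (otherCrossings G g x.support (fun b => y.support \ {b, y b}) P).card)) := by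
  obtain ⟨v, h⟩ := P
  simp only [crossings, Finset.mem_filter, Finset.mem_univ, true_and] at hP
  obtain ⟨hv, hvA, hvB⟩ := hP
  set r : Perm α := h * g * (h : Perm α)⁻¹ with hr
  set c : Perm α := r * x * r⁻¹ with hc
  have hrG : r ∈ G := G.mul_mem (G.mul_mem h.2 hg) (G.inv_mem h.2)
  have hcG : c ∈ G := G.mul_mem (G.mul_mem hrG hx) (G.inv_mem hrG)
  have hmemc : ∀ w, (h : Perm α) (g w) ∈ c.support ↔ (h : Perm α) w ∈ x.support := by
    intro w
    simp [hc, hr, Equiv.symm_apply_eq]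
  set z := (h : Perm α) (g v) with hz
  have hzc : z ∈ c.support := (hmemc v).2 hvA
  set S := c.support ∩ y.support with hS
  have hzS : z ∈ S := Finset.mem_inter.2 ⟨hzc, hvB⟩
  have hcov : ∀ u, ∃ w, (h : Perm α) (g w) = u := fun u =>
    ⟨g⁻¹ ((h : Perm α)⁻¹ u), by simp⟩
  have hother : (S \ {z, y z}).card ≤
      (otherCrossings G g x.support (fun b => y.support \ {b, y b}) (v, h)).card := by
    refine Finset.card_le_card_of_surjOn (fun w => (h : Perm α) (g w)) ?_
    intro u hu
    obtain ⟨w, rfl⟩ := hcov u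
    refine ⟨w, ?_, rfl⟩
    simp only [Finset.coe_sdiff, Set.mem_sdiff, Finset.mem_coe, Finset.mem_insert,
      Finset.mem_singleton, not_or, hS, Finset.mem_inter, hmemc] at hu
    simp only [otherCrossings, Finset.mem_coe, Finset.mem_filter, Finset.mem_univ, true_and,
      Finset.mem_sdiff, Finset.mem_insert, Finset.mem_singleton, not_or]
    refine ⟨?_, hu.1.1, hu.1.2, hu.2.1, hu.2.2⟩
    rintro rfl
    exact hu.2.1 rfl
  have hkG : y * c * y⁻¹ * c⁻¹ ∈ G :=
    G.mul_mem (G.mul_mem (G.mul_mem hy hcG) (G.inv_mem hy)) (G.inv_mem hcG)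
  have hcomm : y * c * y⁻¹ * c⁻¹ = 1 → (∀ u ∈ S, y u ∈ S) ∧ 6 ≤ S.card := by
    intro hk
    have hyc : y * c = c * y := by
      rwa [mul_inv_eq_one, mul_inv_eq_iff_eq_mul] at hk
    have hyc' : ∀ u, y (c u) = c (y u) := fun u => Perm.congr_fun hyc u
    have h1 : ∀ u ∈ S, y u ∈ S := by
      intro u hu
      simp only [hS, Finset.mem_inter, Perm.mem_support] at hu ⊢
      exact ⟨by rw [← hyc']; exact y.injective.ne hu.1, y.injective.ne hu.2⟩
    have h2 : ∀ u ∈ S, c u ∈ S := by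
      intro u hu
      simp only [hS, Finset.mem_inter, Perm.mem_support] at hu ⊢
      exact ⟨c.injective.ne hu.1, by rw [hyc']; exact c.injective.ne hu.2⟩
    have hcp : c ^ p = 1 := by rw [hc, conj_pow, hxp, mul_one, mul_inv_cancel]
    exact ⟨h1, six_le_of_dvd hp hq hpq
      (prime_dvd_card_of_invariant hp hcp Finset.inter_subset_left h2)
      (prime_dvd_card_of_invariant hq hyq Finset.inter_subset_right h1)
      (Finset.card_pos.2 ⟨z, hzS⟩)⟩
  by_cases hyz : y z ∈ S
  · right
    have hcard : S.card ≤ (S \ {z, y z}).card + 2 := by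
      have := Finset.card_le_card_sdiff_add_card (s := S) (t := {z, y z})
      have := Finset.card_le_two (a := z) (b := y z)
      omega
    constructor
    · obtain ⟨w, hw⟩ := hcov (y z)
      refine Finset.card_pos.2 ⟨w, ?_⟩
      simp only [otherCrossings, Finset.mem_filter, Finset.mem_univ, true_and,
        Finset.mem_singleton]
      refine ⟨?_, (hmemc w).1 (hw ▸ (Finset.mem_inter.1 hyz).1), hw⟩
      rintro rfl
      exact Perm.mem_support.1 hvB hw.symm
    · by_cases hk : y * c * y⁻¹ * c⁻¹ = 1
      · right
        have := (hcomm hk).2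
        omega
      · left
        have h1 := hmin _ hkG hk
        have h2 := card_support_commutator_lt y c hzS hyz
        rw [← hS] at h2
        omega
  · left
    have hk : y * c * y⁻¹ * c⁻¹ ≠ 1 := fun hk => hyz ((hcomm hk).1 z hzS)
    have h1 := hmin _ hkG hk
    have h2 := card_support_commutator_le y c
    rw [← hS] at h2
    have hcard : S.card ≤ (S \ {z, y z}).card + 1 := by
      have h3 : S \ {z, y z} = S.erase z := by
        ext u
        simp only [Finset.mem_sdiff, Finset.mem_insert, Finset.mem_singleton, not_or,
          Finset.mem_erase]
        refine ⟨fun h => ⟨h.2.1, h.1⟩, fun h => ⟨h.2, h.1, ?_⟩⟩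
        rintro rfl
        exact hyz h.2
      rw [h3, Finset.card_erase_of_mem hzS]
      omega
    omega

end Commutators

section FourTransitive

variable {α : Type*} [Fintype α] [DecidableEq α]

theorem not_crossing_bound_of_seven_le {m N a b : ℕ} (hm : 7 ≤ m) (hma : m ≤ a + 1)
    (hab : a + b ≤ N) (hba : a ≤ b + 1) :
    (m - 2) * (a * (3 * b + max 2 (m - 15))) < (m - 3) * ((N + 1) * N) := by
  obtain ⟨M, rfl⟩ := Nat.exists_eq_add_of_le' (show 2 ≤ m by omega)
  have e1 : M + 2 - 2 = M := by omega
  have e2 : M + 2 - 3 = M - 1 := by omega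
  obtain ⟨K, hK⟩ : ∃ K, K = max 2 (M + 2 - 15) := ⟨_, rfl⟩
  rw [e1, e2, ← hK]
  have hM : 2 * M + 1 ≤ N := by omega
  have h1 : 4 * (a * b) ≤ N * N := by
    zify at *
    nlinarith [sq_nonneg ((a : ℤ) - b)]
  have h2 : 2 * a ≤ N + 1 := by omega
  have h3 : 4 * (a * (3 * b + K)) ≤ 3 * (N * N) + 2 * (K * (N + 1)) := by nlinarith
  have h4 : M * (3 * (N * N) + 2 * (K * (N + 1))) < 4 * ((M - 1) * ((N + 1) * N)) := by
    obtain ⟨L, rfl⟩ : ∃ L, M = L + 1 := ⟨M - 1, by omega⟩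
    rw [Nat.add_sub_cancel]
    have hN : 11 ≤ N := by omega
    rcases le_or_gt (L + 1 + 2 - 15) 2 with h | h
    · rw [hK, max_eq_left h]
      have : 4 ≤ L := by omega
      nlinarith [Nat.mul_le_mul this hN, mul_le_mul this (Nat.mul_le_mul hN hN),
        Nat.mul_le_mul hN hN]
    · obtain ⟨J, rfl⟩ : ∃ J, L = J + 14 := ⟨L - 14, by omega⟩
      obtain ⟨R, rfl⟩ : ∃ R, N = 2 * (J + 14 + 1) + 1 + R := ⟨_, (Nat.add_sub_of_le hM).symm⟩
      have : K = J + 2 := by omega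
      subst this
      ring_nf
      nlinarith [Nat.zero_le (J * R), Nat.zero_le (J ^ 2 * R), Nat.zero_le (J * R ^ 2),
        Nat.zero_le (J ^ 3), Nat.zero_le (J ^ 2), Nat.zero_le (R ^ 2)]
  have h5 := Nat.mul_le_mul_left M h3
  nlinarith

variable (G : Subgroup (Perm α))

theorem minimal_degree_lt_four [hG : IsMultiplyPretransitive G α 4] {x y g : Perm α} {p q : ℕ}
    (hx : x ∈ G) (hy : y ∈ G) (hg : g ∈ G) (hp : p.Prime) (hq : q.Prime) (hpq : p ≠ q)
    (hxp : x ^ p = 1) (hyq : y ^ q = 1) (hx1 : x ≠ 1) (hxy : x.Disjoint y)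
    (hle : x.support.card ≤ y.support.card)
    (hmin : ∀ k ∈ G, k ≠ 1 → g.support.card ≤ k.support.card) : g.support.card < 4 := by
  classical
  by_contra! hm
  have hma : g.support.card ≤ x.support.card := hmin x hx hx1
  have hdis : _root_.Disjoint x.support y.support := Perm.disjoint_iff_disjoint_support.1 hxy
  have hsum : x.support.card + y.support.card ≤ Fintype.card α := by
    rw [← Finset.card_union_of_disjoint hdis]
    exact Finset.card_le_univ _
  obtain ⟨κ, hκ, H⟩ := exists_crossing_counts G (show 4 ≤ Fintype.card α by omega)
  obtain ⟨hP, hF⟩ := H g x.support y.support hdis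
  have hS := hF (fun b => y.support \ {b, y b}) (y.support.card - 2)
    (fun b _ => Finset.sdiff_subset) (fun b hb => by
      have hb' : y b ≠ b := by simpa using hb
      rw [Finset.card_sdiff_of_subset, Finset.card_pair hb'.symm]
      rw [Finset.insert_subset_iff, Finset.singleton_subset_iff]
      exact ⟨hb, Perm.apply_mem_support.2 hb⟩)
  have hT := hF (fun b => {y b}) 1 (fun b hb => by
    simpa [Finset.singleton_subset_iff] using hb) (fun b _ => Finset.card_singleton _)
  set m := g.support.card
  set P := crossings G g x.support y.support
  set s := fun p => (otherCrossings G g x.support (fun b => y.support \ {b, y b}) p).card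
  set t := fun p => (otherCrossings G g x.support (fun b => {y b}) p).card
  have hdich : ∀ p ∈ P, m ≤ 3 * s p + 3 ∨ (1 ≤ t p ∧ (m ≤ 3 * s p + 5 ∨ 4 ≤ s p)) :=
    crossing_dichotomy G hx hy hg hp hq hpq hxp hyq hmin
  obtain ⟨a, ha⟩ : ∃ a, x.support.card = a + 1 := ⟨x.support.card - 1, by omega⟩
  obtain ⟨b, hb⟩ : ∃ b, y.support.card = b + 2 := ⟨y.support.card - 2, by omega⟩
  obtain ⟨N, hN⟩ : ∃ N, Fintype.card α = N + 3 := ⟨Fintype.card α - 3, by omega⟩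
  rw [ha, hb, hN] at hP
  rw [ha, hb] at hS hT
  rw [show N + 3 - 2 = N + 1 by omega, show N + 3 - 3 = N by omega] at hP
  rw [show a + 1 - 1 = a by omega, show b + 2 - 2 = b by omega] at hS
  rw [show a + 1 - 1 = a by omega] at hT
  have key : ∀ c u v : ℕ, (∀ p ∈ P, c ≤ u * s p + v * t p) →
      c * ((N + 1) * N) ≤ (m - 2) * (a * (u * b + v)) := by
    intro c u v h
    have h1 : P.card * c ≤ u * ∑ p ∈ P, s p + v * ∑ p ∈ P, t p := by
      rw [Finset.mul_sum, Finset.mul_sum, ← Finset.sum_add_distrib, ← smul_eq_mul]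
      exact Finset.card_nsmul_le_sum _ _ _ h
    have h2 : (m * ((a + 1) * (b + 2)) * κ) * (c * ((N + 1) * N)) ≤
        (m * ((a + 1) * (b + 2)) * κ) * ((m - 2) * (a * (u * b + v))) :=
      calc _ = m * ((a + 1) * ((b + 2) * ((N + 1) * N))) * κ * c := by ring
        _ ≤ P.card * c := Nat.mul_le_mul_right _ hP
        _ ≤ _ := h1
        _ ≤ _ := Nat.add_le_add (Nat.mul_le_mul_left u hS) (Nat.mul_le_mul_left v hT)
        _ = _ := by ring
    exact Nat.le_of_mul_le_mul_left h2 (by positivity)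
  have hab : a + b ≤ N := by omega
  have h4 : 4 * (a * b) ≤ N * N := by
    zify at *
    nlinarith [sq_nonneg ((a : ℤ) - b)]
  rcases lt_trichotomy m 6 with h | h | h
  · have h1 := key 1 1 1 fun p hp => by
      rcases hdich p hp with h | h <;> omega
    have h5 : 4 * (a * (b + 1)) ≤ (N + 1) * (N + 1) := by
      zify at *
      nlinarith [sq_nonneg ((a : ℤ) - (b + 1))]
    have h6 : (m - 2) * (a * (1 * b + 1)) ≤ 3 * (a * (b + 1)) := by
      rw [one_mul]
      exact Nat.mul_le_mul_right _ (by omega)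
    have : 5 ≤ N := by omega
    nlinarith
  · have h1 := key 1 1 0 fun p hp => by
      rcases hdich p hp with h | h <;> omega
    rw [h] at h1
    have : 5 ≤ N := by omega
    nlinarith
  · have h1 := key (m - 3) 3 (max 2 (m - 15)) fun p hp => by
      have hK1 := le_max_left 2 (m - 15)
      have hK2 := le_max_right 2 (m - 15)
      rcases hdich p hp with h | ⟨h, h'⟩
      · exact (show m - 3 ≤ 3 * s p by omega).trans (Nat.le_add_right _ _)
      · have := Nat.le_mul_of_pos_right (max 2 (m - 15)) h
        omega
    exact absurd h1 (not_le.2 (not_crossing_bound_of_seven_le h (by omega) hab (by omega)))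

/-- A `4`-transitive group containing two disjoint permutations of distinct prime orders contains
the alternating group. -/
theorem alternatingGroup_le_of_disjoint_of_prime_pow [hG : IsMultiplyPretransitive G α 4]
    (hα : 4 ≤ Fintype.card α) {x y : Perm α} {p q : ℕ}
    (hx : x ∈ G) (hy : y ∈ G) (hp : p.Prime) (hq : q.Prime) (hpq : p ≠ q)
    (hxp : x ^ p = 1) (hyq : y ^ q = 1) (hx1 : x ≠ 1) (hy1 : y ≠ 1) (hxy : x.Disjoint y) :
    alternatingGroup α ≤ G := by
  classical
  obtain ⟨g, hg, hmin⟩ := Finset.exists_min_image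
    (Finset.univ.filter fun k : Perm α => k ∈ G ∧ k ≠ 1) (fun k => k.support.card)
    ⟨x, by simp [hx, hx1]⟩
  simp only [Finset.mem_filter, Finset.mem_univ, true_and] at hg hmin
  have h4 : g.support.card < 4 := by
    rcases le_total x.support.card y.support.card with h | h
    · exact minimal_degree_lt_four G hx hy hg.1 hp hq hpq hxp hyq hx1 hxy h
        fun k hk hk1 => hmin k ⟨hk, hk1⟩
    · exact minimal_degree_lt_four G hy hx hg.1 hq hp hpq.symm hyq hxp hy1 hxy.symm h
        fun k hk hk1 => hmin k ⟨hk, hk1⟩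
  have : IsMultiplyPretransitive G α 2 :=
    isMultiplyPretransitive_of_le' (n := 4) (by norm_num) (by simpa using hα)
  have hprim : IsPreprimitive G α := isPreprimitive_of_is_two_pretransitive this
  have h2 := Perm.two_le_card_support_of_ne_one hg.2
  rcases (show g.support.card = 2 ∨ g.support.card = 3 by omega) with h | h
  · rw [Perm.subgroup_eq_top_of_isPreprimitive_of_isSwap_mem hprim g (Perm.card_support_eq_two.1 h)
      hg.1]
    exact le_top
  · exact Perm.alternatingGroup_le_of_isPreprimitive_of_isThreeCycle_mem hprim
      (_root_.card_support_eq_three_iff.1 h) hg.1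

end FourTransitive

section TransitivityExtension

variable {G α : Type*} [Group G] [MulAction G α]

/-- The element `g` acts as a nontrivial cycle. -/
def ActsAsCycle (α : Type*) [MulAction G α] (g : G) : Prop :=
  (∃ x : α, g • x ≠ x) ∧ ∀ x y : α, g • x ≠ x → g • y ≠ y → ∃ i : ℤ, g ^ i • x = y

theorem toPerm_zpow_smul (g : G) (i : ℤ) (x : α) : (toPerm g ^ i : Perm α) x = g ^ i • x :=
  Perm.congr_fun (map_zpow (toPermHom G α) g i).symm x

theorem zpow_smul_eq_self_of_smul_eq_self {g : G} {x : α} (h : g • x = x) (i : ℤ) :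
    g ^ i • x = x :=
  (stabilizer G x).zpow_mem h i

theorem ActsAsCycle.exists_smul_smul_ne {g : G} (hg : ActsAsCycle α g) :
    ∃ x y : α, x ≠ y ∧ g • x ≠ x ∧ g • y ≠ y := by
  obtain ⟨x, hx⟩ := hg.1
  exact ⟨x, g • x, hx.symm, hx, fun h => hx (smul_left_cancel g h)⟩

theorem isMultiplyPretransitive_two_of_actsAsCycle [Finite α] (hG : IsPreprimitive G α) {g : G}
    (hg : ActsAsCycle α g) {β : α} (hβ : g • β = β) : IsMultiplyPretransitive G α 2 := by
  set s : Set α := {x | g • x = x} with hs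
  have hpos : 0 < s.ncard := (Set.ncard_pos).2 ⟨β, hβ⟩
  refine IsPreprimitive.is_two_pretransitive hG (s := s) (n := s.ncard - 1) (by omega) ?_ ?_
  · obtain ⟨x, y, hxy, hx, hy⟩ := hg.exists_smul_smul_ne
    have h1 := Set.ncard_add_ncard_compl s
    have h2 : 2 ≤ sᶜ.ncard := by
      rw [← Set.ncard_pair hxy]
      refine Set.ncard_le_ncard ?_
      rintro z (rfl | rfl)
      · exact hx
      · exact hy
    omega
  · refine ⟨fun x y => ?_⟩
    obtain ⟨i, hi⟩ := hg.2 x y x.2 y.2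
    have hmem : g ∈ fixingSubgroup G s := by
      rw [mem_fixingSubgroup_iff]
      exact fun z hz => hz
    exact ⟨⟨g, hmem⟩ ^ i, Subtype.ext hi⟩

theorem ActsAsCycle.stabilizer {g : G} (hg : ActsAsCycle α g) {β : α} (hβ : g • β = β) :
    ActsAsCycle (SubMulAction.ofStabilizer G β) (⟨g, hβ⟩ : stabilizer G β) := by
  refine ⟨?_, ?_⟩
  · obtain ⟨x, hx⟩ := hg.1
    refine ⟨⟨x, ?_⟩, fun h => hx (congrArg Subtype.val h)⟩
    rintro rfl
    exact hx hβ
  · intro x y hx hy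
    obtain ⟨i, hi⟩ := hg.2 x y (fun h => hx (Subtype.ext h)) (fun h => hy (Subtype.ext h))
    exact ⟨i, Subtype.ext hi⟩

/-- In a finite cyclic permutation group, subgroups of the same order agree. -/
theorem subgroup_le_of_card_eq {C H K : Subgroup G} [Finite C] [IsCyclic C]
    (hH : H ≤ C) (hK : K ≤ C) (h : Nat.card H = Nat.card K) : H ≤ K := by
  classical
  have := Fintype.ofFinite C
  have hKfin : Finite K := Finite.of_injective _ (Subgroup.inclusion_injective hK)
  have := Fintype.ofFinite K
  have hpow : ∀ (M : Subgroup G), ∀ a ∈ M, a ^ Nat.card M = 1 := fun M a ha =>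
    congrArg Subtype.val (pow_card_eq_one' (x := (⟨a, ha⟩ : M)))
  have hsub : (Finset.univ.image (Subgroup.inclusion hK)) ⊆
      Finset.univ.filter fun a : C => a ^ Nat.card K = 1 := by
    intro a ha
    simp only [Finset.mem_image, Finset.mem_univ, true_and] at ha
    obtain ⟨a, rfl⟩ := ha
    simp only [Finset.mem_filter, Finset.mem_univ, true_and]
    exact Subtype.ext (by simpa using hpow K a a.2)
  have heq := Finset.eq_of_subset_of_card_le hsub (by
    rw [Finset.card_image_of_injective _ (Subgroup.inclusion_injective hK), Finset.card_univ,
      ← Nat.card_eq_fintype_card]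
    exact IsCyclic.card_pow_eq_one_le Nat.card_pos)
  intro a ha
  have : (⟨a, hH ha⟩ : C) ∈ Finset.univ.filter fun a : C => a ^ Nat.card K = 1 := by
    simp only [Finset.mem_filter, Finset.mem_univ, true_and]
    exact Subtype.ext (by simpa [h] using hpow H a ha)
  rw [← heq, Finset.mem_image] at this
  obtain ⟨b, -, hb⟩ := this
  have : (b : G) = a := congrArg Subtype.val hb
  exact this ▸ b.2

/-- A family of equivalence relations on the complements of the points, permuted by a group. -/
structure IsPointwiseCongruence (G : Type*) {α : Type*} [Group G] [MulAction G α]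
    (R : α → α → α → Prop) : Prop where
  smul : ∀ (g : G) {β x y}, R β x y → R (g • β) (g • x) (g • y)
  ne : ∀ {β x y}, R β x y → x ≠ β
  refl : ∀ {β x}, x ≠ β → R β x x
  symm : ∀ {β x y}, R β x y → R β y x
  trans : ∀ {β x y z}, R β x y → R β y z → R β x z

namespace IsPointwiseCongruence

variable {R : α → α → α → Prop}

theorem smul_iff (hR : IsPointwiseCongruence G R) (g : G) {β x y : α} :
    R (g • β) (g • x) (g • y) ↔ R β x y := by
  refine ⟨fun h => ?_, hR.smul g⟩
  simpa using hR.smul g⁻¹ h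

theorem zpow (hR : IsPointwiseCongruence G R) {g : G} {β x y : α} (hβ : g • β = β) (i : ℤ)
    (h : R β x y) : R β (g ^ i • x) (g ^ i • y) := by
  have := hR.smul (g ^ i) h
  rwa [zpow_smul_eq_self_of_smul_eq_self hβ] at this

theorem smul_of_fixed (hR : IsPointwiseCongruence G R) {g : G} {β x y : α} (hβ : g • β = β)
    (h : R β x y) : R β (g • x) (g • y) := by
  have := hR.smul g h
  rwa [hβ] at this

theorem rel_zpow (hR : IsPointwiseCongruence G R) {g : G} {β x : α} (hβ : g • β = β)
    (h : R β x (g • x)) (i : ℤ) : R β x (g ^ i • x) := by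
  have hx := hR.refl (hR.ne h)
  induction i using Int.induction_on with
  | zero => simpa using hx
  | succ i ih =>
    rw [zpow_add, zpow_one, mul_smul]
    exact hR.trans ih (hR.zpow hβ _ h)
  | pred i ih =>
    refine hR.trans ih (hR.symm ?_)
    have := hR.zpow hβ (-(i : ℤ) - 1) h
    rwa [← mul_smul, ← zpow_add_one, sub_add_cancel] at this

variable [Fintype α] [DecidableEq α]

open Classical in
theorem exists_card_class (hR : IsPointwiseCongruence G R) [h2 : IsMultiplyPretransitive G α 2] :
    ∃ b : ℕ, ∀ β x, x ≠ β → (Finset.univ.filter (R β x)).card = b := by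
  by_cases h : ∃ β x : α, x ≠ β
  · obtain ⟨β₀, x₀, h₀⟩ := h
    refine ⟨(Finset.univ.filter (R β₀ x₀)).card, fun β x hx => ?_⟩
    · rw [is_two_pretransitive_iff] at h2
      obtain ⟨g, hg1, hg2⟩ := h2 h₀ hx
      subst hg1 hg2
      symm
      refine Finset.card_bij (fun y _ => g • y) ?_ ?_ ?_
      · intro y hy
        simpa [hR.smul_iff] using hy
      · intro y _ z _ h
        exact smul_left_cancel g h
      · intro y hy
        refine ⟨g⁻¹ • y, ?_, by simp⟩
        rw [Finset.mem_filter] at hy ⊢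
        rw [← hR.smul_iff g, smul_inv_smul]
        exact ⟨Finset.mem_univ _, hy.2⟩
  · push Not at h
    exact ⟨0, fun β x hx => absurd (h β x) hx⟩

open Classical in
theorem card_filter_rel (hR : IsPointwiseCongruence G R) [h2 : IsMultiplyPretransitive G α 2]
    {b : ℕ} (hb : ∀ β x, x ≠ β → (Finset.univ.filter (R β x)).card = b) {x y : α} (hxy : x ≠ y) :
    (Finset.univ.filter fun β => R β x y).card + 1 = b := by
  have hconst : ∀ z ∈ Finset.univ.erase x, (Finset.univ.filter fun β => R β x z).card =
      (Finset.univ.filter fun β => R β x y).card := by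
    intro z hz
    have hz : x ≠ z := (Finset.ne_of_mem_erase hz).symm
    rw [is_two_pretransitive_iff] at h2
    obtain ⟨g, hg1, hg2⟩ := h2 hz hxy
    refine Finset.card_bij (fun β _ => g • β) ?_ ?_ ?_
    · intro β hβ
      have := hR.smul g (Finset.mem_filter.1 hβ).2
      rw [hg1, hg2] at this
      simpa using this
    · intro y _ z _ h
      exact smul_left_cancel g h
    · intro β hβ
      refine ⟨g⁻¹ • β, ?_, by simp⟩
      rw [Finset.mem_filter] at hβ ⊢
      rw [← hR.smul_iff g, smul_inv_smul, hg1, hg2]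
      exact ⟨Finset.mem_univ _, hβ.2⟩
  have hclass : ∀ β ∈ Finset.univ.erase x, ((Finset.univ.erase x).filter (R β x)).card = b - 1 := by
    intro β hβ
    have hβ : x ≠ β := (Finset.ne_of_mem_erase hβ).symm
    rw [← hb β x hβ, Finset.filter_erase, Finset.card_erase_of_mem]
    simpa using hR.refl hβ
  have hdouble := Finset.sum_card_bipartiteAbove_eq_sum_card_bipartiteBelow (fun β z => R β x z)
    (s := Finset.univ.erase x) (t := Finset.univ.erase x)
  have hbelow : ∀ z ∈ Finset.univ.erase x,
      (Finset.bipartiteBelow (fun β z => R β x z) (Finset.univ.erase x) z).card =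
      (Finset.univ.filter fun β => R β x y).card := by
    intro z hz
    rw [← hconst z hz]
    congr 1
    ext β
    simp only [Finset.bipartiteBelow, Finset.mem_filter, Finset.mem_erase, Finset.mem_univ,
      true_and, and_true, and_iff_right_iff_imp]
    exact fun h => (hR.ne h).symm
  rw [Finset.sum_congr rfl hbelow] at hdouble
  change ∑ β ∈ Finset.univ.erase x, ((Finset.univ.erase x).filter (R β x)).card = _ at hdouble
  rw [Finset.sum_congr rfl hclass, Finset.sum_const,
    Finset.sum_const, smul_eq_mul, smul_eq_mul] at hdouble
  have hpos : 0 < (Finset.univ.erase x).card := Finset.card_pos.2 ⟨y, by simpa using hxy.symm⟩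
  have := Nat.eq_of_mul_eq_mul_left hpos hdouble
  have hb1 : 0 < b := by
    rw [← hb y x hxy]
    exact Finset.card_pos.2 ⟨x, by simpa using hR.refl hxy⟩
  omega

section Cycle

variable {g : G}

/-- The elements of the cyclic group generated by `g` preserving the class of `x`. -/
def classSubgroup (hR : IsPointwiseCongruence G R) (g : G) {β x : α} (hβ : g • β = β)
    (hx : x ≠ β) : Subgroup (Perm α) where
  carrier := {h | h ∈ Subgroup.zpowers (toPerm g : Perm α) ∧ R β x (h x)}
  one_mem' := ⟨one_mem _, hR.refl hx⟩
  mul_mem' := by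
    rintro _ _ ⟨⟨i, rfl⟩, hi⟩ ⟨⟨j, rfl⟩, hj⟩
    refine ⟨mul_mem ⟨i, rfl⟩ ⟨j, rfl⟩, hR.trans hi ?_⟩
    have := hR.zpow hβ i hj
    simpa only [toPerm_zpow_smul, Perm.mul_apply] using this
  inv_mem' := by
    rintro _ ⟨⟨i, rfl⟩, hi⟩
    refine ⟨inv_mem ⟨i, rfl⟩, hR.symm ?_⟩
    have := hR.zpow hβ (-i) hi
    simpa only [← zpow_neg, toPerm_zpow_smul, ← mul_smul, ← zpow_add,
      neg_add_cancel, zpow_zero, one_smul] using this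

omit [Fintype α] [DecidableEq α] in
theorem rel_smul_of_rel (hR : IsPointwiseCongruence G R) (hg : ActsAsCycle α g) {β x z w : α}
    (hβ : g • β = β) (hx : g • x ≠ x) (hz : g • z ≠ z) (hw : g • w = w) (h : R β z w) :
    R β x (g • x) := by
  have h1 : R β z (g • z) := by
    refine hR.trans h (hR.symm ?_)
    have := hR.smul_of_fixed hβ h
    rwa [hw] at this
  obtain ⟨i, rfl⟩ := hg.2 z x hz hx
  have := hR.zpow hβ i h1
  rwa [← mul_smul, ← zpow_add_one, add_comm, zpow_add, zpow_one, mul_smul] at this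

open Classical in
theorem card_classSubgroup (hR : IsPointwiseCongruence G R) (hg : ActsAsCycle α g) {β x : α}
    (hβ : g • β = β) (hxβ : x ≠ β) (hx : g • x ≠ x) (hR' : ¬ R β x (g • x)) :
    Nat.card (hR.classSubgroup g hβ hxβ) = (Finset.univ.filter (R β x)).card := by
  rw [← Fintype.card_coe, ← Nat.card_eq_fintype_card]
  refine Nat.card_congr (Equiv.ofBijective (fun h => ⟨h.1 x, by simpa using h.2.2⟩) ⟨?_, ?_⟩)
  · rintro ⟨_, ⟨i, rfl⟩, hi⟩ ⟨_, ⟨j, rfl⟩, hj⟩ hij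
    have hij : g ^ i • x = g ^ j • x := by
      simpa only [toPerm_zpow_smul] using congrArg Subtype.val hij
    refine Subtype.ext (Equiv.ext fun z => ?_)
    simp only [toPerm_zpow_smul]
    by_cases hz : g • z = z
    · rw [zpow_smul_eq_self_of_smul_eq_self hz, zpow_smul_eq_self_of_smul_eq_self hz]
    · obtain ⟨k, rfl⟩ := hg.2 x z hx hz
      rw [← mul_smul, ← mul_smul, zpow_mul_comm, zpow_mul_comm g j, mul_smul, mul_smul, hij]
  · rintro ⟨y, hy⟩
    have hy : R β x y := by simpa using hy
    have hy' : g • y ≠ y := fun h => hR' (hR.rel_smul_of_rel hg hβ hx hx h hy)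
    obtain ⟨i, rfl⟩ := hg.2 x y hx hy'
    refine ⟨⟨toPerm g ^ i, ⟨i, rfl⟩, ?_⟩, ?_⟩
    · simpa only [toPerm_zpow_smul] using hy
    · simp only [toPerm_zpow_smul]

theorem trivial_or_full (hR : IsPointwiseCongruence G R) [h2 : IsMultiplyPretransitive G α 2]
    (hg : ActsAsCycle α g) {β β' : α} (hβ : g • β = β) (hβ' : g • β' = β') (hne : β ≠ β') :
    (∀ γ x y, R γ x y → x = y) ∨ (∀ γ x y, x ≠ γ → y ≠ γ → R γ x y) := by
  classical
  by_contra! hcon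
  obtain ⟨⟨γ, u, v, huv, huv'⟩, γ', x', y', hx', hy', hxy'⟩ := hcon
  obtain ⟨b, hb⟩ := hR.exists_card_class
  have hb2 : 2 ≤ b := by
    rw [← hb γ u (hR.ne huv), ← Finset.card_pair huv']
    refine Finset.card_le_card fun z hz => ?_
    rw [Finset.mem_insert, Finset.mem_singleton] at hz
    rcases hz with rfl | rfl
    · simpa using hR.refl (hR.ne huv)
    · simpa using huv
  have hbn : 2 * b + 1 ≤ Fintype.card α := by
    have hd : Disjoint (Finset.univ.filter (R γ' x')) (Finset.univ.filter (R γ' y')) := by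
      rw [Finset.disjoint_left]
      intro z hz hz'
      simp only [Finset.mem_filter, Finset.mem_univ, true_and] at hz hz'
      exact hxy' (hR.trans hz (hR.symm hz'))
    have hγ' : γ' ∉ Finset.univ.filter (R γ' x') ∪ Finset.univ.filter (R γ' y') := by
      simp only [Finset.mem_union, Finset.mem_filter, Finset.mem_univ, true_and]
      rintro (h | h) <;> exact hR.ne (hR.symm h) rfl
    have := Finset.card_le_univ (insert γ'
      (Finset.univ.filter (R γ' x') ∪ Finset.univ.filter (R γ' y')))
    rw [Finset.card_insert_of_notMem hγ', Finset.card_union_of_disjoint hd, hb _ _ hx',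
      hb _ _ hy'] at this
    omega
  set F := Finset.univ.filter fun f : α => g • f = f with hF
  have hmemF : ∀ f, f ∈ F ↔ g • f = f := fun f => by simp [hF]
  have hcommon : ∀ x y, x ≠ y → (∀ f ∈ F, R f x y) → F.card + 1 ≤ b := by
    intro x y hxy h
    rw [← hR.card_filter_rel hb hxy]
    exact Nat.succ_le_succ (Finset.card_le_card fun f hf => by simpa using h f hf)
  obtain ⟨x, hx⟩ := hg.1
  have hxF : ∀ f ∈ F, x ≠ f := by
    rintro f hf rfl
    exact hx ((hmemF x).1 hf)
  by_cases hI : ∀ f ∈ F, R f x (g • x)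
  · have h1 := hcommon x (g • x) hx.symm hI
    have h3 : Fᶜ.card ≤ b := by
      rw [← hb β x (hxF β ((hmemF β).2 hβ))]
      refine Finset.card_le_card fun z hz => ?_
      rw [Finset.mem_compl, hmemF] at hz
      obtain ⟨i, rfl⟩ := hg.2 x z hx hz
      simpa using hR.rel_zpow hβ (hI β ((hmemF β).2 hβ)) i
    have := Finset.card_add_card_compl F
    omega
  · push Not at hI
    obtain ⟨f₁, hf₁, hR₁⟩ := hI
    have hf₁' := (hmemF f₁).1 hf₁
    have h1 : b + 1 ≤ F.card := by
      obtain ⟨f, hf, hff⟩ : ∃ f ∈ F, f ≠ f₁ := by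
        by_cases h : β = f₁
        · exact ⟨β', (hmemF _).2 hβ', h ▸ hne.symm⟩
        · exact ⟨β, (hmemF _).2 hβ, h⟩
      rw [← hb f₁ f hff, ← Finset.card_insert_of_notMem (a := f₁)]
      · refine Finset.card_le_card fun z hz => ?_
        rw [Finset.mem_insert] at hz
        rcases hz with rfl | hz
        · exact hf₁
        · rw [hmemF]
          by_contra hz'
          exact hR₁ (hR.rel_smul_of_rel hg hf₁' hx hz' ((hmemF f).1 hf)
            (hR.symm (Finset.mem_filter.1 hz).2))
      · simp only [Finset.mem_filter, Finset.mem_univ, true_and]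
        exact fun h => hR.ne (hR.symm h) rfl
    obtain ⟨y, hy, hyx⟩ := Finset.exists_mem_ne
      (show 1 < (Finset.univ.filter (R f₁ x)).card by rw [hb f₁ x (hxF f₁ hf₁)]; omega) x
    have hy : R f₁ x y := by simpa using hy
    have hy' : g • y ≠ y := fun h => hR₁ (hR.rel_smul_of_rel hg hf₁' hx hx h hy)
    obtain ⟨i, rfl⟩ := hg.2 x y hx hy'
    have := hcommon x _ hyx.symm fun f hf => ?_
    · omega
    have hf' := (hmemF f).1 hf
    by_cases hRf : R f x (g • x)
    · exact hR.rel_zpow hf' hRf i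
    · have hle := subgroup_le_of_card_eq (C := Subgroup.zpowers (toPerm g : Perm α))
        (H := hR.classSubgroup g hf₁' (hxF f₁ hf₁)) (K := hR.classSubgroup g hf' (hxF f hf))
        (fun _ h => h.1) (fun _ h => h.1) (by
          rw [hR.card_classSubgroup hg _ _ hx hR₁, hR.card_classSubgroup hg _ _ hx hRf,
            hb _ _ (hxF f₁ hf₁), hb _ _ (hxF f hf)])
      have hmem : (toPerm g : Perm α) ^ i ∈ hR.classSubgroup g hf₁' (hxF f₁ hf₁) :=
        ⟨⟨i, rfl⟩, by simpa only [toPerm_zpow_smul] using hy⟩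
      simpa only [toPerm_zpow_smul] using (hle hmem).2

end Cycle

end IsPointwiseCongruence

variable [Fintype α] [DecidableEq α] {g : G}

theorem isPreprimitive_ofStabilizer [h2 : IsMultiplyPretransitive G α 2]
    (hg : ActsAsCycle α g) {β β' : α} (hβ : g • β = β) (hβ' : g • β' = β') (hne : β ≠ β') :
    IsPreprimitive (stabilizer G β) (SubMulAction.ofStabilizer G β) := by
  have := h2
  rw [is_two_pretransitive_iff] at h2
  have htrans : IsPretransitive (stabilizer G β) (SubMulAction.ofStabilizer G β) := by
    refine ⟨fun x y => ?_⟩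
    obtain ⟨h, h1, h3⟩ := h2 (show β ≠ x from fun h => x.2 h.symm)
      (show β ≠ y from fun h => y.2 h.symm)
    exact ⟨⟨h, h1⟩, Subtype.ext h3⟩
  refine ⟨fun {B} hB => ?_⟩
  rcases B.eq_empty_or_nonempty with rfl | ⟨u, hu⟩
  · exact Or.inl Set.subsingleton_empty
  have hBmem : ∀ (h : stabilizer G β) {v w}, v ∈ B → h • v ∈ B → w ∈ B → h • w ∈ B := by
    intro h v w hv hv' hw
    rw [← hB.smul_eq_of_mem hv hv']
    exact Set.smul_mem_smul_set hw
  have hR : IsPointwiseCongruence G fun γ x y : α =>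
      ∃ h : G, h • β = γ ∧ ∃ v ∈ B, ∃ w ∈ B, x = h • (v : α) ∧ y = h • (w : α) := by
    refine ⟨?_, ?_, ?_, ?_, ?_⟩
    · rintro k γ x y ⟨h, rfl, v, hv, w, hw, rfl, rfl⟩
      exact ⟨k * h, mul_smul _ _ _, v, hv, w, hw, (mul_smul _ _ _).symm, (mul_smul _ _ _).symm⟩
    · rintro γ x y ⟨h, rfl, v, hv, w, hw, rfl, rfl⟩ hh
      exact v.2 (smul_left_cancel h hh)
    · intro γ x hx
      obtain ⟨h, h1, h3⟩ := h2 (show β ≠ u from fun h => u.2 h.symm) hx.symm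
      exact ⟨h, h1, u, hu, u, hu, h3.symm, h3.symm⟩
    · rintro γ x y ⟨h, h1, v, hv, w, hw, h3, h4⟩
      exact ⟨h, h1, w, hw, v, hv, h4, h3⟩
    · rintro γ x y z ⟨h, rfl, v, hv, w, hw, rfl, rfl⟩ ⟨k, hk, v', hv', w', hw', h3, rfl⟩
      have hs : h⁻¹ * k ∈ stabilizer G β := by
        rw [mem_stabilizer_iff, mul_smul, hk, inv_smul_smul]
      have e : (⟨h⁻¹ * k, hs⟩ : stabilizer G β) • v' = w := by
        refine Subtype.ext ?_
        change (h⁻¹ * k) • (v' : α) = w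
        rw [mul_smul, ← h3, inv_smul_smul]
      refine ⟨h, rfl, v, hv, _, hBmem ⟨h⁻¹ * k, hs⟩ hv' (e ▸ hw) hw', rfl, ?_⟩
      change k • (w' : α) = h • ((h⁻¹ * k) • (w' : α))
      rw [mul_smul, smul_inv_smul]
  rcases hR.trivial_or_full hg hβ hβ' hne with h | h
  · left
    intro v hv w hw
    exact Subtype.ext (h β v w ⟨1, one_smul _ _, v, hv, w, hw, (one_smul _ _).symm,
      (one_smul _ _).symm⟩)
  · right
    refine Set.eq_univ_of_forall fun w => ?_
    obtain ⟨k, hk, v, hv, w', hw', h3, h4⟩ := h β u w u.2 w.2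
    have e1 : u = (⟨k, hk⟩ : stabilizer G β) • v := Subtype.ext h3
    have e2 : w = (⟨k, hk⟩ : stabilizer G β) • w' := Subtype.ext h4
    rw [e2]
    exact hBmem _ hv (e1 ▸ hu) hw'

theorem isMultiplyPretransitive_ofStabilizer_two [h2 : IsMultiplyPretransitive G α 2]
    (hg : ActsAsCycle α g) {β b : α} (hβ : g • β = β) (hb : g • b = b) (hne : β ≠ b) :
    IsMultiplyPretransitive (stabilizer G β) (SubMulAction.ofStabilizer G β) 2 :=
  isMultiplyPretransitive_two_of_actsAsCycle (isPreprimitive_ofStabilizer hg hβ hb hne)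
    (hg.stabilizer hβ) (β := ⟨b, hne.symm⟩) (Subtype.ext hb)

/-- A primitive group containing a cycle with three fixed points is `4`-transitive. -/
theorem isMultiplyPretransitive_four_of_actsAsCycle (hG : IsPreprimitive G α)
    (hg : ActsAsCycle α g) {β₁ β₂ β₃ : α} (h₁ : g • β₁ = β₁) (h₂ : g • β₂ = β₂)
    (h₃ : g • β₃ = β₃) (h12 : β₁ ≠ β₂) (h13 : β₁ ≠ β₃) (h23 : β₂ ≠ β₃) :
    IsMultiplyPretransitive G α 4 := by
  classical
  have := Fintype.ofFinite (SubMulAction.ofStabilizer G β₁)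
  have := isMultiplyPretransitive_two_of_actsAsCycle hG hg h₁
  have hstab := isMultiplyPretransitive_ofStabilizer_two hg h₁ h₂ h12
  have hstab' := isMultiplyPretransitive_ofStabilizer_two (hg.stabilizer h₁)
    (β := ⟨β₂, h12.symm⟩) (b := ⟨β₃, h13.symm⟩) (Subtype.ext h₂) (Subtype.ext h₃)
    (fun h => h23 (congrArg Subtype.val h))
  have : IsPretransitive G α := hG.toIsPretransitive
  have : IsPretransitive (stabilizer G β₁) (SubMulAction.ofStabilizer G β₁) :=
    isPretransitive_of_is_two_pretransitive
  rw [SubMulAction.ofStabilizer.isMultiplyPretransitive (n := 3) (a := β₁),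
    SubMulAction.ofStabilizer.isMultiplyPretransitive (n := 2) (a := ⟨β₂, h12.symm⟩)]
  exact hstab'

end TransitivityExtension

end PermutationGroups

open scoped Pointwise in
theorem isPreprimitive_of_forall_setoid {G α : Type*} [Group G] [MulAction G α]
    [MulAction.IsPretransitive G α]
    (h : ∀ r : Setoid α, (∀ (g : G) (x y), r x y → r (g • x) (g • y)) →
      (∀ x y, r x y → x = y) ∨ ∀ x y, r x y) : MulAction.IsPreprimitive G α := by
  refine ⟨fun {B} hB => ?_⟩
  rcases B.eq_empty_or_nonempty with rfl | ⟨b, hb⟩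
  · exact Or.inl Set.subsingleton_empty
  let r : Setoid α :=
    { r := fun x y => ∀ g : G, g • x ∈ B ↔ g • y ∈ B
      iseqv := ⟨fun x g => Iff.rfl, fun h g => (h g).symm, fun h h' g => (h g).trans (h' g)⟩ }
  have hr : ∀ {x y}, r x y ↔ ∀ g : G, g • x ∈ B ↔ g • y ∈ B := Iff.rfl
  have hrB : ∀ x ∈ B, ∀ y ∈ B, r x y := by
    intro x hx y hy g
    have key : ∀ x ∈ B, ∀ y ∈ B, g • x ∈ B → g • y ∈ B := by
      intro x hx y hy hgx
      have : g • B = B := hB.smul_eq_of_nonempty ⟨g • x, Set.smul_mem_smul_set hx, hgx⟩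
      exact this ▸ Set.smul_mem_smul_set hy
    exact ⟨key x hx y hy, key y hy x hx⟩
  rcases h r (fun g x y hxy k => by simpa only [mul_smul] using hxy (k * g)) with h | h
  · exact Or.inl fun x hx y hy => h x y (hrB x hx y hy)
  · refine Or.inr (Set.eq_univ_of_forall fun x => ?_)
    simpa using (hr.1 (h b x) 1).1 (by simpa using hb)

section ToggleBasics

variable {L : Finset (Finset E)}

theorem toggle_val_of_mem {e : E} {X : {A : Finset E // A ∈ L}}
    (h : X.1 ∆ ({e} : Finset E) ∈ L) : (toggle L e X).1 = X.1 ∆ {e} := by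
  change (if h : X.1 ∆ ({e} : Finset E) ∈ L then (⟨X.1 ∆ ({e} : Finset E), h⟩ :
    {A : Finset E // A ∈ L}) else X).1 = _
  rw [dif_pos h]

theorem toggle_eq_self_of_notMem {e : E} {X : {A : Finset E // A ∈ L}}
    (h : X.1 ∆ ({e} : Finset E) ∉ L) : toggle L e X = X := by
  change (if h : X.1 ∆ ({e} : Finset E) ∈ L then (⟨X.1 ∆ ({e} : Finset E), h⟩ :
    {A : Finset E // A ∈ L}) else X) = _
  rw [dif_neg h]

theorem symmDiff_singleton_ne (A : Finset E) (e : E) : A ∆ {e} ≠ A := by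
  intro h
  rw [symmDiff_eq_left] at h
  exact Finset.singleton_ne_empty e h

theorem toggle_ne_self_iff {e : E} {X : {A : Finset E // A ∈ L}} :
    toggle L e X ≠ X ↔ X.1 ∆ ({e} : Finset E) ∈ L := by
  constructor
  · exact fun h => by_contra fun h' => h (toggle_eq_self_of_notMem h')
  · intro h h'
    have := toggle_val_of_mem h
    rw [h'] at this
    exact symmDiff_singleton_ne _ _ this.symm

theorem toggle_val_of_ne {e : E} {X : {A : Finset E // A ∈ L}} (h : toggle L e X ≠ X) :
    (toggle L e X).1 = X.1 ∆ {e} :=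
  toggle_val_of_mem (toggle_ne_self_iff.1 h)

theorem toggle_toggle (e : E) (X : {A : Finset E // A ∈ L}) :
    toggle L e (toggle L e X) = X :=
  (toggle L e).symm.apply_symm_apply X

theorem toggle_mem (e : E) : toggle L e ∈ toggleGroup L :=
  Subgroup.subset_closure ⟨e, rfl⟩

theorem toggle_inv (e : E) : (toggle L e)⁻¹ = toggle L e := rfl

/-- The subgroup generated by the toggles of elements of `S`. -/
def toggleSubgroup (L : Finset (Finset E)) (S : Set E) :
    Subgroup (Equiv.Perm {A : Finset E // A ∈ L}) :=
  Subgroup.closure (toggle L '' S)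

theorem toggleSubgroup_univ : toggleSubgroup L Set.univ = toggleGroup L := by
  rw [toggleSubgroup, Set.image_univ, toggleGroup]

theorem toggleSubgroup_le (S : Set E) : toggleSubgroup L S ≤ toggleGroup L :=
  Subgroup.closure_mono (Set.image_subset_range _ _)

theorem toggleSubgroup_induction {S : Set E} {P : Equiv.Perm {A : Finset E // A ∈ L} → Prop}
    (one : P 1) (mul : ∀ e ∈ S, ∀ g, P g → P (toggle L e * g)) {g}
    (hg : g ∈ toggleSubgroup L S) : P g := by
  induction hg using Subgroup.closure_induction_left with
  | one => exact one
  | mul_left x hx y _ ih =>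
    obtain ⟨e, he, rfl⟩ := hx
    exact mul e he y ih
  | inv_mul_cancel x hx y _ ih =>
    obtain ⟨e, he, rfl⟩ := hx
    rw [toggle_inv]
    exact mul e he y ih

theorem toggleGroup_induction {P : Equiv.Perm {A : Finset E // A ∈ L} → Prop}
    (one : P 1) (mul : ∀ e g, P g → P (toggle L e * g)) {g} (hg : g ∈ toggleGroup L) : P g :=
  toggleSubgroup_induction (S := Set.univ) one (fun e _ => mul e)
    (toggleSubgroup_univ (L := L) ▸ hg)

theorem toggle_eq_of_val_eq {e : E} {X Y : {A : Finset E // A ∈ L}} (h : Y.1 = X.1 ∆ {e}) :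
    toggle L e X = Y :=
  Subtype.ext ((toggle_val_of_mem (h ▸ Y.2)).trans h.symm)

end ToggleBasics

section Primitivity

variable {L : Finset (Finset E)}

/-- An equivalence relation on `L` is a congruence if it is preserved by the toggle group. -/
def IsCongruence (r : Setoid {A : Finset E // A ∈ L}) : Prop :=
  ∀ g ∈ toggleGroup L, ∀ X Y, r X Y → r (g X) (g Y)

/-- The toggle `τ_e` does not move any point within its class. -/
def MovesClasses (r : Setoid {A : Finset E // A ∈ L}) (e : E) : Prop :=
  ∀ X, r X (toggle L e X) → toggle L e X = X

/-- The toggle `τ_e` preserves every class. -/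
def FixesClasses (r : Setoid {A : Finset E // A ∈ L}) (e : E) : Prop :=
  ∀ X, r X (toggle L e X)

variable {r : Setoid {A : Finset E // A ∈ L}}

theorem IsCongruence.toggle (hr : IsCongruence r) (e : E) {X Y : {A : Finset E // A ∈ L}}
    (h : r X Y) : r (toggle L e X) (toggle L e Y) :=
  hr _ (toggle_mem e) X Y h

theorem fixesClasses_of_not_movesClasses (hr : IsCongruence r) (htrans : IsTransitive L) {e : E}
    (he : ¬ MovesClasses r e) : FixesClasses r e := by
  simp only [MovesClasses, not_forall] at he
  obtain ⟨X₀, h₀, h₀'⟩ := he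
  let Q : {A : Finset E // A ∈ L} → Prop := fun X =>
    ∃ Y, r X Y ∧ r Y (toggle L e Y) ∧ toggle L e Y ≠ Y
  have hstep : ∀ f X, Q X → Q (toggle L f X) := by
    rintro f X ⟨Y, hXY, hY, hY'⟩
    by_cases hfY : r Y (toggle L f Y)
    · exact ⟨Y, r.trans (hr.toggle f hXY) (r.symm hfY), hY, hY'⟩
    · have h1 : toggle L f Y ≠ Y := fun h => hfY (h.symm ▸ r.refl Y)
      have h2 : toggle L f (toggle L e Y) ≠ toggle L e Y := by
        intro h
        have := hr.toggle f hY
        rw [h] at this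
        exact hfY (r.trans hY (r.symm this))
      have h3 : toggle L e (toggle L f Y) = toggle L f (toggle L e Y) := by
        refine toggle_eq_of_val_eq ?_
        rw [toggle_val_of_ne h1, toggle_val_of_ne h2, toggle_val_of_ne hY', symmDiff_right_comm]
      refine ⟨toggle L f Y, hr.toggle f hXY, ?_, ?_⟩
      · rw [h3]
        exact hr.toggle f hY
      · rw [h3]
        exact fun h => hY' ((TogglePaper.toggle L f).injective h)
  have hall : ∀ g ∈ toggleGroup L, Q (g X₀) := fun g hg =>
    toggleGroup_induction ⟨X₀, r.refl _, h₀, h₀'⟩ (fun f g => hstep f (g X₀)) hg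
  intro X
  obtain ⟨g, hg, rfl⟩ := htrans X₀ X
  obtain ⟨Y, hXY, hY, -⟩ := hall g hg
  exact r.trans hXY (r.trans hY (r.symm (hr.toggle e hXY)))

theorem commute_toggle (hr : IsCongruence r) {e f : E} (he : MovesClasses r e)
    (hf : FixesClasses r f) : Commute (toggle L e) (toggle L f) := by
  refine Equiv.ext fun X => ?_
  change toggle L e (toggle L f X) = toggle L f (toggle L e X)
  have hstep : ∀ X, toggle L e X ≠ X → toggle L e (toggle L f X) ≠ toggle L f X := by
    intro X hX h
    refine hX (he X ?_)
    have h1 := hr.toggle e (hf X)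
    rw [h] at h1
    exact r.trans (hf X) (r.symm h1)
  have hstep' : ∀ X, toggle L e (toggle L f X) ≠ toggle L f X → toggle L e X ≠ X := by
    intro X h
    have := hstep _ h
    rwa [toggle_toggle] at this
  by_cases hX : toggle L e X = X
  · rw [hX]
    by_contra h
    exact hstep' X h hX
  · have h1 := hstep X hX
    by_cases hfX : toggle L f X = X
    · rw [hfX]
      by_contra hne
      have h2 := toggle_val_of_ne (Ne.symm hne)
      have h3 := hstep (toggle L e X) (by rw [toggle_toggle]; exact Ne.symm hX)
      have h4 := toggle_val_of_ne h3
      have h5 : (toggle L e (toggle L f (toggle L e X))).1 = X.1 ∆ {f} := by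
        rw [h4, h2, toggle_val_of_ne hX, symmDiff_right_comm, symmDiff_symmDiff_cancel_right]
      exact toggle_ne_self_iff.2 (h5 ▸ Subtype.prop _) hfX
    · symm
      refine toggle_eq_of_val_eq ?_
      rw [toggle_val_of_ne h1, toggle_val_of_ne hfX, toggle_val_of_ne hX, symmDiff_right_comm]

/-- The subgroup generated by the toggles that move classes. -/
abbrev movingSubgroup (r : Setoid {A : Finset E // A ∈ L}) :
    Subgroup (Equiv.Perm {A : Finset E // A ∈ L}) :=
  toggleSubgroup L {e | MovesClasses r e}

/-- The subgroup generated by the toggles that preserve classes. -/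
abbrev stillSubgroup (r : Setoid {A : Finset E // A ∈ L}) :
    Subgroup (Equiv.Perm {A : Finset E // A ∈ L}) :=
  toggleSubgroup L {e | ¬ MovesClasses r e}

theorem commute_of_mem (hr : IsCongruence r) (htrans : IsTransitive L)
    {g h : Equiv.Perm {A : Finset E // A ∈ L}} (hg : g ∈ movingSubgroup r)
    (hh : h ∈ stillSubgroup r) : Commute g h := by
  refine toggleSubgroup_induction (P := fun g => Commute g h) (Commute.one_left h)
    (fun e he g ih => ?_) hg
  refine Commute.mul_left ?_ ih
  refine toggleSubgroup_induction (P := fun h => Commute (toggle L e) h) (Commute.one_right _)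
    (fun f hf h ih => ?_) hh
  exact (commute_toggle hr he (fixesClasses_of_not_movesClasses hr htrans hf)).mul_right ih

theorem exists_mul_of_mem_toggleGroup (hr : IsCongruence r) (htrans : IsTransitive L)
    {g : Equiv.Perm {A : Finset E // A ∈ L}} (hg : g ∈ toggleGroup L) :
    ∃ g₁ ∈ movingSubgroup r, ∃ g₂ ∈ stillSubgroup r, g = g₁ * g₂ := by
  refine toggleGroup_induction
    (P := fun g => ∃ g₁ ∈ movingSubgroup r, ∃ g₂ ∈ stillSubgroup r, g = g₁ * g₂)
    ⟨1, one_mem _, 1, one_mem _, (mul_one 1).symm⟩ ?_ hg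
  rintro e _ ⟨g₁, h₁, g₂, h₂, rfl⟩
  by_cases he : MovesClasses r e
  · exact ⟨toggle L e * g₁, mul_mem (Subgroup.subset_closure ⟨e, he, rfl⟩) h₁, g₂, h₂,
      (mul_assoc _ _ _).symm⟩
  · have he' : toggle L e ∈ stillSubgroup r := Subgroup.subset_closure ⟨e, he, rfl⟩
    refine ⟨g₁, h₁, toggle L e * g₂, mul_mem he' h₂, ?_⟩
    rw [← mul_assoc, ← mul_assoc, (commute_of_mem hr htrans h₁ he').eq]

theorem rel_apply_of_mem_stillSubgroup (hr : IsCongruence r) (htrans : IsTransitive L)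
    {g : Equiv.Perm {A : Finset E // A ∈ L}} (hg : g ∈ stillSubgroup r)
    (X : {A : Finset E // A ∈ L}) : r X (g X) := by
  refine toggleSubgroup_induction (P := fun g => r X (g X)) (r.refl X) (fun e he g ih => ?_) hg
  exact r.trans ih (fixesClasses_of_not_movesClasses hr htrans he (g X))

theorem symmDiff_toggle (hr : IsCongruence r) {e : E} (he : MovesClasses r e)
    {X Y : {A : Finset E // A ∈ L}} (h : r X Y) :
    (toggle L e X).1 ∆ (toggle L e Y).1 = X.1 ∆ Y.1 := by
  have key : ∀ X Y, r X Y → toggle L e X = X → toggle L e Y = Y := fun X Y h hX => by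
    have := hr.toggle e h
    rw [hX] at this
    exact he Y (r.trans (r.symm h) this)
  by_cases hX : toggle L e X = X
  · rw [hX, key X Y h hX]
  · have hY : toggle L e Y ≠ Y := fun hY => hX (key Y X (r.symm h) hY)
    rw [toggle_val_of_ne hX, toggle_val_of_ne hY, symmDiff_symmDiff_symmDiff_comm, symmDiff_self,
      symmDiff_bot]

theorem symmDiff_apply_of_mem_movingSubgroup (hr : IsCongruence r)
    {g : Equiv.Perm {A : Finset E // A ∈ L}} (hg : g ∈ movingSubgroup r)
    {X Y : {A : Finset E // A ∈ L}} (h : r X Y) : (g X).1 ∆ (g Y).1 = X.1 ∆ Y.1 := by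
  refine (toggleSubgroup_induction (P := fun g => r (g X) (g Y) ∧ (g X).1 ∆ (g Y).1 = X.1 ∆ Y.1)
    ⟨h, rfl⟩ (fun e he g ih => ?_) hg).2
  exact ⟨hr.toggle e ih.1, (symmDiff_toggle hr he ih.1).trans ih.2⟩

theorem mem_of_mem_symmDiff_apply {S : Set E} {g : Equiv.Perm {A : Finset E // A ∈ L}}
    (hg : g ∈ toggleSubgroup L S) (X : {A : Finset E // A ∈ L}) {e : E}
    (he : e ∈ X.1 ∆ (g X).1) : e ∈ S := by
  revert he
  refine toggleSubgroup_induction (P := fun g => e ∈ X.1 ∆ (g X).1 → e ∈ S) (by simp)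
    (fun f hf g ih he => ?_) hg
  change e ∈ X.1 ∆ (toggle L f (g X)).1 at he
  by_cases h : toggle L f (g X) = g X
  · rw [h] at he
    exact ih he
  · rw [toggle_val_of_ne h, ← symmDiff_assoc, Finset.mem_symmDiff, Finset.mem_singleton] at he
    rcases he with ⟨he, -⟩ | ⟨rfl, -⟩
    · exact ih he
    · exact hf

theorem eq_of_forall_notMem_symmDiff {X Y : {A : Finset E // A ∈ L}} (h : ∀ e, e ∉ X.1 ∆ Y.1) :
    X = Y :=
  Subtype.ext (symmDiff_eq_bot.1 (Finset.eq_empty_of_forall_notMem h))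

theorem exists_movingSubgroup_rel (hr : IsCongruence r) (htrans : IsTransitive L)
    (X Y : {A : Finset E // A ∈ L}) : ∃ g ∈ movingSubgroup r, r (g X) Y := by
  obtain ⟨g, hg, rfl⟩ := htrans X Y
  obtain ⟨g₁, h₁, g₂, h₂, rfl⟩ := exists_mul_of_mem_toggleGroup hr htrans hg
  exact ⟨g₁, h₁, hr _ (toggleSubgroup_le _ h₁) _ _
    (rel_apply_of_mem_stillSubgroup hr htrans h₂ X)⟩

theorem mem_movingSubgroup_of_fixes_class (hr : IsCongruence r) (htrans : IsTransitive L)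
    {γ : Equiv.Perm {A : Finset E // A ∈ L}} (hγ : γ ∈ toggleGroup L)
    {W : {A : Finset E // A ∈ L}} (hW : ∀ Y, r W Y → γ Y = Y) : γ ∈ movingSubgroup r := by
  obtain ⟨g₁, h₁, g₂, h₂, rfl⟩ := exists_mul_of_mem_toggleGroup hr htrans hγ
  have hfix : ∀ Y, r W Y → g₂ Y = Y := by
    intro Y hY
    refine (eq_of_forall_notMem_symmDiff fun e he => ?_).symm
    have h3 := mem_of_mem_symmDiff_apply h₂ Y he
    have h4 : g₁ (g₂ Y) = Y := hW Y hY
    refine h3 (mem_of_mem_symmDiff_apply h₁ (g₂ Y) ?_)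
    rwa [h4, symmDiff_comm]
  have h₂' : g₂ = 1 := by
    refine Equiv.ext fun Z => ?_
    obtain ⟨h, hh, hrel⟩ := exists_movingSubgroup_rel hr htrans Z W
    have := hfix _ (r.symm hrel)
    have hc : h (g₂ Z) = g₂ (h Z) :=
      Equiv.Perm.congr_fun (commute_of_mem hr htrans hh h₂).eq Z
    rw [← hc] at this
    exact h.injective this
  rwa [h₂', mul_one]

theorem sign_toggle_eq_one (hr : IsCongruence r) {D : Finset E} (hD : D.Nonempty)
    (hDL : ∀ Z : {A : Finset E // A ∈ L}, ∃ Z' : {A : Finset E // A ∈ L}, r Z Z' ∧ Z'.1 = Z.1 ∆ D)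
    {e : E} (he : MovesClasses r e) : Equiv.Perm.sign (toggle L e) = 1 := by
  by_cases hne : ∃ d ∈ D, d ≠ e
  swap
  · have hDe : D = {e} :=
      Finset.eq_singleton_iff_nonempty_unique_mem.2 ⟨hD,
        fun d hd => by_contra fun h => hne ⟨d, hd, h⟩⟩
    have h1 : toggle L e = 1 := Equiv.ext fun X => by
      obtain ⟨X', h, hX'⟩ := hDL X
      rw [hDe] at hX'
      exact he X ((toggle_eq_of_val_eq hX').symm ▸ h)
    rw [h1, map_one]
  obtain ⟨d, hd, hde⟩ := hne
  choose t ht ht' using hDL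
  have htt : Function.Involutive t := fun X => Subtype.ext (by
    rw [ht', ht', symmDiff_symmDiff_cancel_right])
  have htd : ∀ X, d ∈ (t X).1 ↔ d ∉ X.1 := fun X => by
    rw [ht', Finset.mem_symmDiff]
    tauto
  have hed : ∀ X, d ∈ (toggle L e X).1 ↔ d ∈ X.1 := fun X => by
    by_cases h : toggle L e X = X
    · rw [h]
    · rw [toggle_val_of_ne h, Finset.mem_symmDiff, Finset.mem_singleton]
      tauto
  have hcomm : ∀ X, toggle L e (t X) = t (toggle L e X) := fun X => by
    refine Subtype.ext ?_
    have := symmDiff_toggle hr he (ht X)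
    rw [ht', symmDiff_symmDiff_cancel_left] at this
    rw [ht', ← this, symmDiff_symmDiff_cancel_left]
  let a : Equiv.Perm {A : Finset E // A ∈ L} := Function.Involutive.toPerm
    (fun X => if d ∈ X.1 then toggle L e X else X) (fun X => by
      by_cases h : d ∈ X.1
      · simp only [if_pos h, (hed X).2 h, if_true, toggle_toggle]
      · simp only [if_neg h])
  have ha : ∀ X, a X = if d ∈ X.1 then toggle L e X else X := fun X => rfl
  let s : Equiv.Perm {A : Finset E // A ∈ L} := Function.Involutive.toPerm t htt
  have hs : ∀ X, s X = t X := fun X => rfl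
  have key : toggle L e = a * (s * a * s) := Equiv.ext fun X => by
    simp only [Equiv.Perm.mul_apply, hs, ha, htd]
    by_cases h : d ∈ X.1
    · simp [h, htt X, (htd X).not.2 (not_not.2 h)]
    · simp [h, hcomm, htt (toggle L e X), (htd _).2 ((hed X).not.2 h)]
  rw [key]
  simp only [map_mul]
  rcases Int.units_eq_one_or (Equiv.Perm.sign a) with h | h <;>
    rcases Int.units_eq_one_or (Equiv.Perm.sign s) with h' | h' <;> simp [h, h']

theorem congruence_trivial_or_full (hr : IsCongruence r) (htrans : IsTransitive L)
    {γ : Equiv.Perm {A : Finset E // A ∈ L}} (hγ : γ ∈ toggleGroup L) (hcyc : γ.IsCycle)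
    {X₀ : {A : Finset E // A ∈ L}} (hX₀ : γ X₀ = X₀) :
    (∀ X Y, r X Y → X = Y) ∨ ∀ X Y, r X Y := by
  by_contra! h
  obtain ⟨⟨A, B, hAB, hAB'⟩, A', B', hAB''⟩ := h
  have hfixz : ∀ i : ℤ, (γ ^ i) X₀ = X₀ := fun i =>
    Equiv.Perm.zpow_apply_eq_self_of_apply_eq_self hX₀ i
  have hmem : γ ∈ movingSubgroup r := by
    by_cases h0 : ∀ Y, r X₀ Y → γ Y = Y
    · exact mem_movingSubgroup_of_fixes_class hr htrans hγ h0
    · push Not at h0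
      obtain ⟨Y₀, hY₀, hY₀'⟩ := h0
      have hmoved : ∀ Z, γ Z ≠ Z → r X₀ Z := fun Z hZ => by
        obtain ⟨i, rfl⟩ := hcyc.exists_zpow_eq hY₀' hZ
        have := hr (γ ^ i) (zpow_mem hγ i) _ _ hY₀
        rwa [hfixz] at this
      obtain ⟨W, hW⟩ : ∃ W, ¬ r X₀ W := by
        by_contra! hall
        exact hAB'' (r.trans (r.symm (hall A')) (hall B'))
      refine mem_movingSubgroup_of_fixes_class hr htrans hγ (W := W) fun Y hY => ?_
      by_contra hne
      exact hW (r.trans (hmoved Y hne) (r.symm hY))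
  obtain ⟨x, hx, hx'⟩ := hcyc
  have hcyc : γ.IsCycle := ⟨x, hx, hx'⟩
  have hpow : ∀ i : ℤ, (γ ^ i) x = x → γ ^ i = 1 := fun i hi => by
    refine Equiv.ext fun z => ?_
    by_cases hz : γ z = z
    · exact Equiv.Perm.zpow_apply_eq_self_of_apply_eq_self hz i
    · obtain ⟨j, rfl⟩ := hx' hz
      rw [← Equiv.Perm.mul_apply, zpow_mul_comm, Equiv.Perm.mul_apply, hi, Equiv.Perm.one_apply]
  obtain ⟨Y, hxY, hne⟩ : ∃ Y, r x Y ∧ Y ≠ x := by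
    obtain ⟨g, hg, rfl⟩ := htrans A x
    exact ⟨g B, hr g hg _ _ hAB, fun h => hAB' (g.injective h).symm⟩
  have hmoved : ∀ Y, r x Y → γ Y ≠ Y := fun Y hY h => by
    have := symmDiff_apply_of_mem_movingSubgroup hr hmem hY
    rw [h, symmDiff_left_inj] at this
    exact hx (Subtype.ext this)
  have hsq : ∀ i : ℤ, r x ((γ ^ i) x) → γ ^ (2 * i) = 1 := fun i hi => by
    refine hpow _ (Subtype.ext ?_)
    have := symmDiff_apply_of_mem_movingSubgroup hr (zpow_mem hmem i) hi
    rw [symmDiff_comm, symmDiff_left_inj, ← Equiv.Perm.mul_apply, ← zpow_add,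
      ← two_mul] at this
    exact this
  have heven : Even (orderOf γ) := by
    obtain ⟨i, rfl⟩ := hx' (hmoved Y hxY)
    have h2 := orderOf_dvd_iff_zpow_eq_one.2 (hsq i hxY)
    have h1 : ¬ (orderOf γ : ℤ) ∣ i := fun h => hne (by
      rw [orderOf_dvd_iff_zpow_eq_one.1 h, Equiv.Perm.one_apply])
    by_contra hodd
    rw [Nat.not_even_iff_odd] at hodd
    refine h1 (IsCoprime.dvd_of_dvd_mul_left ?_ h2)
    rw [← Nat.cast_two, Nat.isCoprime_iff_coprime]
    exact hodd.coprime_two_right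
  have hsign : Equiv.Perm.sign γ = -1 := by
    rw [hcyc.sign, ← hcyc.orderOf, heven.neg_one_pow]
  have hsign' : Equiv.Perm.sign γ = 1 := by
    refine toggleSubgroup_induction (P := fun g => Equiv.Perm.sign g = 1) (map_one _)
      (fun e he g ih => ?_) hmem
    rw [map_mul, ih, mul_one]
    refine sign_toggle_eq_one hr (D := x.1 ∆ Y.1) ?_ (fun Z => ?_) he
    · rw [Finset.nonempty_iff_ne_empty, ← Finset.bot_eq_empty, Ne, symmDiff_eq_bot]
      exact fun h => hne (Subtype.ext h.symm)
    · obtain ⟨g, hg, hgZ⟩ := exists_movingSubgroup_rel hr htrans x Z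
      have hrel : r x (g⁻¹ Z) := by
        simpa using hr g⁻¹ (inv_mem (toggleSubgroup_le _ hg)) _ _ hgZ
      obtain ⟨k, hk⟩ := hx' (hmoved _ hrel)
      have hZ : (g * γ ^ k) x = Z := by
        rw [Equiv.Perm.mul_apply, hk]
        exact g.apply_symm_apply Z
      have hmem' := mul_mem hg (zpow_mem hmem k)
      refine ⟨(g * γ ^ k) Y, ?_, ?_⟩
      · have := hr _ (toggleSubgroup_le _ hmem') _ _ hxY
        rwa [hZ] at this
      · have := symmDiff_apply_of_mem_movingSubgroup hr hmem' hxY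
        rw [hZ] at this
        rw [← this, symmDiff_symmDiff_cancel_left]
  rw [hsign'] at hsign
  exact absurd hsign (by decide)

theorem isPreprimitive_toggleGroup (htrans : IsTransitive L)
    {γ : Equiv.Perm {A : Finset E // A ∈ L}} (hγ : γ ∈ toggleGroup L) (hcyc : γ.IsCycle)
    {X₀ : {A : Finset E // A ∈ L}} (hX₀ : γ X₀ = X₀) :
    MulAction.IsPreprimitive (toggleGroup L) {A : Finset E // A ∈ L} := by
  have : MulAction.IsPretransitive (toggleGroup L) {A : Finset E // A ∈ L} :=
    ⟨fun X Y => (htrans X Y).elim fun g hg => ⟨⟨g, hg.1⟩, hg.2⟩⟩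
  refine isPreprimitive_of_forall_setoid fun r hr => ?_
  exact congruence_trivial_or_full (fun g hg X Y h => hr ⟨g, hg⟩ X Y h) htrans hγ hcyc hX₀

end Primitivity

section TogglePairs

variable {L : Finset (Finset E)}

theorem toggle_mk {e : E} {A : Finset E} (hA : A ∈ L) :
    toggle L e ⟨A, hA⟩ = if h : A ∆ {e} ∈ L then ⟨A ∆ {e}, h⟩ else ⟨A, hA⟩ := rfl

theorem toggle_pair_sq_or_cube (e f : E) (X : {A : Finset E // A ∈ L}) :
    ((toggle L e * toggle L f) ^ 2) X = X ∨ ((toggle L e * toggle L f) ^ 3) X = X := by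
  obtain ⟨A, hA⟩ := X
  have h1 : A ∆ {e} ∆ {e} = A := symmDiff_symmDiff_cancel_right _ _
  have h2 : A ∆ {f} ∆ {f} = A := symmDiff_symmDiff_cancel_right _ _
  have h3 : A ∆ {f} ∆ {e} = A ∆ {e} ∆ {f} := symmDiff_right_comm _ _ _
  have h4 : A ∆ {e} ∆ {f} ∆ {f} = A ∆ {e} := symmDiff_symmDiff_cancel_right _ _
  have h5 : A ∆ {e} ∆ {f} ∆ {e} = A ∆ {f} := by
    rw [← h3, symmDiff_symmDiff_cancel_right]
  by_cases he : A ∆ {e} ∈ L <;> by_cases hf : A ∆ {f} ∈ L <;> by_cases hef : A ∆ {e} ∆ {f} ∈ L <;>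
    simp [pow_succ, toggle_mk, h1, h2, h3, h4, h5, he, hf, hef, hA]

theorem mem_symmDiff_iff_of_commute {e f : E} (hne : e ≠ f)
    (h : (toggle L e * toggle L f) ^ 2 = 1)
    {A : Finset E} (hA : A ∈ L) (he : A ∆ {e} ∈ L) : A ∆ {e} ∆ {f} ∈ L ↔ A ∆ {f} ∈ L := by
  have h1 : A ∆ {e} ∆ {e} = A := symmDiff_symmDiff_cancel_right _ _
  have h2 : A ∆ {f} ∆ {f} = A := symmDiff_symmDiff_cancel_right _ _
  have h3 : A ∆ {f} ∆ {e} = A ∆ {e} ∆ {f} := symmDiff_right_comm _ _ _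
  have h4 : A ∆ {e} ∆ {f} ∆ {f} = A ∆ {e} := symmDiff_symmDiff_cancel_right _ _
  have h5 : A ∆ {e} ∆ {f} ∆ {e} = A ∆ {f} := by
    rw [← h3, symmDiff_symmDiff_cancel_right]
  have h7 : A ∆ {e} ∆ {f} ≠ A := fun h => hne <| by
    rwa [symmDiff_assoc, symmDiff_eq_left, symmDiff_eq_bot, Finset.singleton_inj] at h
  have h6 := congrArg Subtype.val (Equiv.Perm.congr_fun h ⟨A, hA⟩)
  by_cases hf : A ∆ {f} ∈ L <;> by_cases hef : A ∆ {e} ∆ {f} ∈ L <;>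
    simp [pow_succ, toggle_mk, h1, h2, h3, h4, h5, h7, he, hf, hef, hA] at h6 ⊢

theorem mem_symmDiff_iff_of_braid {e f : E} (hne : e ≠ f) (h : (toggle L e * toggle L f) ^ 3 = 1)
    {A : Finset E} (hA : A ∈ L) (he : A ∆ {e} ∈ L) : A ∆ {e} ∆ {f} ∈ L ↔ A ∆ {f} ∉ L := by
  have h1 : A ∆ {e} ∆ {e} = A := symmDiff_symmDiff_cancel_right _ _
  have h2 : A ∆ {f} ∆ {f} = A := symmDiff_symmDiff_cancel_right _ _
  have h3 : A ∆ {f} ∆ {e} = A ∆ {e} ∆ {f} := symmDiff_right_comm _ _ _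
  have h4 : A ∆ {e} ∆ {f} ∆ {f} = A ∆ {e} := symmDiff_symmDiff_cancel_right _ _
  have h5 : A ∆ {e} ∆ {f} ∆ {e} = A ∆ {f} := by
    rw [← h3, symmDiff_symmDiff_cancel_right]
  have h7 : A ∆ {e} ∆ {f} ≠ A := fun h => hne <| by
    rwa [symmDiff_assoc, symmDiff_eq_left, symmDiff_eq_bot, Finset.singleton_inj] at h
  have h6 := congrArg Subtype.val (Equiv.Perm.congr_fun h ⟨A, hA⟩)
  by_cases hf : A ∆ {f} ∈ L <;> by_cases hef : A ∆ {e} ∆ {f} ∈ L <;>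
    simp [pow_succ, toggle_mk, h1, h2, h3, h4, h5, h7, he, hf, hef, hA] at h6 ⊢

end TogglePairs

section AffineToggles

variable {L : Finset (Finset E)}

/-- The characteristic vector of a subset of the ground set over the two-element field. -/
def indicatorVec (A : Finset E) (e : E) : ZMod 2 := if e ∈ A then 1 else 0

theorem indicatorVec_injective : Function.Injective (indicatorVec (E := E)) := fun A B h => by
  ext e
  have := congrFun h e
  by_cases hA : e ∈ A <;> by_cases hB : e ∈ B <;> simp_all [indicatorVec]

theorem indicatorVec_symmDiff_singleton (A : Finset E) (f : E) :
    indicatorVec (A ∆ {f}) = indicatorVec A + Pi.single f 1 := by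
  funext e
  by_cases hA : e ∈ A <;> by_cases hf : e = f <;>
    simp_all [indicatorVec, Finset.mem_symmDiff, CharTwo.add_self_eq_zero]

/-- The value is `1` if the toggle `τ_f` moves `X` and `0` otherwise. -/
def moveBit (L : Finset (Finset E)) (f : E) (A : Finset E) : ZMod 2 := if A ∆ {f} ∈ L then 1 else 0

theorem indicatorVec_toggle (f : E) (X : {A : Finset E // A ∈ L}) :
    indicatorVec (toggle L f X).1 = indicatorVec X.1 + Pi.single f (moveBit L f X.1) := by
  by_cases h : X.1 ∆ {f} ∈ L
  · rw [toggle_val_of_mem h, indicatorVec_symmDiff_singleton, moveBit, if_pos h]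
  · rw [toggle_eq_self_of_notMem h, moveBit, if_neg h, Pi.single_zero, add_zero]

theorem exists_moveBit_eq [Fintype E] (htrans : IsTransitive L) (f : E)
    (hf : ∀ e, e ≠ f → (toggle L e * toggle L f) ^ 2 = 1 ∨ (toggle L e * toggle L f) ^ 3 = 1) :
    ∃ (N : Finset E) (κ : ZMod 2), ∀ X : {A : Finset E // A ∈ L},
      moveBit L f X.1 = κ + ∑ e ∈ N, indicatorVec X.1 e := by
  let N : Finset E := Finset.univ.filter fun e => e ≠ f ∧ (toggle L e * toggle L f) ^ 2 ≠ 1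
  let φ : {A : Finset E // A ∈ L} → ZMod 2 := fun X =>
    moveBit L f X.1 + ∑ e ∈ N, indicatorVec X.1 e
  have hstep : ∀ e X, φ (toggle L e X) = φ X := by
    intro e X
    by_cases he : X.1 ∆ {e} ∈ L
    · simp only [φ, toggle_val_of_mem he, indicatorVec_symmDiff_singleton, Pi.add_apply,
        Finset.sum_add_distrib, Finset.sum_pi_single']
      by_cases hef : e = f
      · subst hef
        have : e ∉ N := by simp [N]
        simp [moveBit, this, symmDiff_symmDiff_cancel_right, X.2, he]
      · by_cases h2 : (toggle L e * toggle L f) ^ 2 = 1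
        · have : e ∉ N := by simp [N, h2]
          simp [moveBit, this, mem_symmDiff_iff_of_commute hef h2 X.2 he]
        · have : e ∈ N := by simp [N, h2, hef]
          have h3 := (hf e hef).resolve_left h2
          by_cases hX : X.1 ∆ {f} ∈ L
          · simp [moveBit, this, mem_symmDiff_iff_of_braid hef h3 X.2 he, hX, add_comm]
          · simp only [moveBit, this, mem_symmDiff_iff_of_braid hef h3 X.2 he, hX, if_true,
              not_false_eq_true, if_false]
            rw [add_left_comm, CharTwo.add_self_eq_zero, add_zero, zero_add]
    · rw [toggle_eq_self_of_notMem he]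
  rcases isEmpty_or_nonempty {A : Finset E // A ∈ L} with hL | ⟨⟨X₀⟩⟩
  · exact ⟨∅, 0, fun X => isEmptyElim X⟩
  refine ⟨N, φ X₀, fun X => ?_⟩
  obtain ⟨g, hg, rfl⟩ := htrans X₀ X
  have : φ (g X₀) = φ X₀ := toggleGroup_induction (P := fun g => φ (g X₀) = φ X₀) rfl
    (fun e g ih => (hstep e _).trans ih) hg
  rw [← this]
  simp only [φ]
  rw [add_assoc, CharTwo.add_self_eq_zero, add_zero]

theorem sum_indicatorVec_eq_zero [Fintype E] (htrans : IsTransitive L)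
    (hL : ∀ e f, e ≠ f → (toggle L e * toggle L f) ^ 2 = 1 ∨ (toggle L e * toggle L f) ^ 3 = 1)
    {g : Equiv.Perm {A : Finset E // A ∈ L}} (hg : g ∈ toggleGroup L)
    {X Y Z W : {A : Finset E // A ∈ L}}
    (h : indicatorVec X.1 + indicatorVec Y.1 + indicatorVec Z.1 + indicatorVec W.1 = 0) :
    indicatorVec (g X).1 + indicatorVec (g Y).1 + indicatorVec (g Z).1 + indicatorVec (g W).1
      = 0 := by
  refine toggleGroup_induction (P := fun g => indicatorVec (g X).1 + indicatorVec (g Y).1 +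
    indicatorVec (g Z).1 + indicatorVec (g W).1 = 0) h (fun f g ih => ?_) hg
  obtain ⟨N, κ, hN⟩ := exists_moveBit_eq htrans f fun e he => hL e f he
  have hbit : moveBit L f (g X).1 + moveBit L f (g Y).1 + moveBit L f (g Z).1 +
      moveBit L f (g W).1 = 0 := by
    have h1 : ∑ e ∈ N, (indicatorVec (g X).1 e + indicatorVec (g Y).1 e + indicatorVec (g Z).1 e +
        indicatorVec (g W).1 e) = 0 := Finset.sum_eq_zero fun e _ => congrFun ih e
    simp only [Finset.sum_add_distrib] at h1
    simp only [hN]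
    linear_combination h1 + (2 * κ) * CharTwo.two_eq_zero (R := ZMod 2)
  have h2 := congrArg (Pi.single (M := fun _ : E => ZMod 2) f) hbit
  simp only [Pi.single_add, Pi.single_zero] at h2
  simp only [Equiv.Perm.mul_apply, indicatorVec_toggle]
  linear_combination ih + h2

theorem isSwap_toggle [Fintype E] (htrans : IsTransitive L)
    [h4 : MulAction.IsMultiplyPretransitive (toggleGroup L) {A : Finset E // A ∈ L} 4]
    (hcard : 5 ≤ L.card)
    (hL : ∀ e f, e ≠ f → (toggle L e * toggle L f) ^ 2 = 1 ∨ (toggle L e * toggle L f) ^ 3 = 1)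
    {f : E} (hf : toggle L f ≠ 1) : (toggle L f).IsSwap := by
  obtain ⟨X, hX⟩ : ∃ X, toggle L f X ≠ X := by
    by_contra! h
    exact hf (Equiv.ext h)
  refine ⟨X, toggle L f X, hX.symm, Equiv.ext fun Y => ?_⟩
  rcases eq_or_ne Y X with rfl | hYX
  · rw [Equiv.swap_apply_left]
  rcases eq_or_ne Y (toggle L f X) with rfl | hYX'
  · rw [Equiv.swap_apply_right, toggle_toggle]
  rw [Equiv.swap_apply_of_ne_of_ne hYX hYX']
  by_contra hY
  have h1 : toggle L f Y ≠ X := fun h => hYX' (by rw [← h, toggle_toggle])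
  have h2 : toggle L f Y ≠ toggle L f X := (toggle L f).injective.ne hYX
  obtain ⟨Z, hZ⟩ :
      ∃ Z, Z ∉ ({X, toggle L f X, Y, toggle L f Y} : Finset {A : Finset E // A ∈ L}) := by
    by_contra! h
    have := Finset.card_le_card (Finset.subset_iff.2 fun Z _ => h Z :
      (Finset.univ : Finset {A : Finset E // A ∈ L}) ⊆ _)
    rw [Finset.card_univ, Fintype.card_coe] at this
    have := this.trans Finset.card_le_four
    omega
  simp only [Finset.mem_insert, Finset.mem_singleton, not_or] at hZ
  obtain ⟨hZ1, hZ2, hZ3, hZ4⟩ := hZ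
  obtain ⟨g, hg⟩ := MulAction.exists_smul_eq (toggleGroup L)
    (fourPoints (X, toggle L f X, Y, toggle L f Y) (by
      simp [hX.symm, hYX.symm, h1.symm, hYX'.symm, h2.symm, Ne.symm hY]))
    (fourPoints (X, toggle L f X, Y, Z) (by
      simp [hX.symm, hYX.symm, Ne.symm hZ1, hYX'.symm, Ne.symm hZ2, Ne.symm hZ3]))
  have hg' := fun i => DFunLike.congr_fun hg i
  have hgX : g.1 X = X := hg' 0
  have hgX' : g.1 (toggle L f X) = toggle L f X := hg' 1
  have hgY : g.1 Y = Y := hg' 2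
  have hgY' : g.1 (toggle L f Y) = Z := hg' 3
  have h0 : indicatorVec X.1 + indicatorVec (toggle L f X).1 + indicatorVec Y.1 +
      indicatorVec (toggle L f Y).1 = 0 := by
    rw [toggle_val_of_ne hX, toggle_val_of_ne hY, indicatorVec_symmDiff_singleton,
      indicatorVec_symmDiff_singleton]
    have htwo : (2 : E → ZMod 2) = 0 := funext fun _ => CharTwo.two_eq_zero
    linear_combination (indicatorVec X.1 + indicatorVec Y.1 + Pi.single f 1) * htwo
  have h0' := sum_indicatorVec_eq_zero htrans hL g.2 h0
  rw [hgX, hgX', hgY, hgY'] at h0'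
  exact hZ4 (Subtype.ext (indicatorVec_injective (add_left_cancel (h0'.trans h0.symm))))

end AffineToggles

/-- a transitive toggle group containing a nontrivial cycle with at
least three fixed points contains the alternating group on `L`. -/
theorem transitive_with_cycle_with_three_fixed_points_contains_alternating
    [Fintype E] (L : Finset (Finset E))
    (hnt : ∀ e : E, toggle L e ≠ 1)
    (htrans : IsTransitive L)
    (γ : Equiv.Perm {A : Finset E // A ∈ L}) (hγ : γ ∈ toggleGroup L)
    (hcyc : γ.IsCycle) (hshort : γ.support.card + 3 ≤ L.card) :
    alternatingGroup {A : Finset E // A ∈ L} ≤ toggleGroup L := by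
  have hcard : 5 ≤ L.card := by
    have := hcyc.two_le_card_support
    omega
  have hfix : 2 < γ.supportᶜ.card := by
    rw [Finset.card_compl, Fintype.card_coe]
    omega
  obtain ⟨β₁, β₂, β₃, h₁, h₂, h₃, h12, h13, h23⟩ := Finset.two_lt_card_iff.1 hfix
  rw [Finset.mem_compl, Equiv.Perm.notMem_support] at h₁ h₂ h₃
  have hprim := isPreprimitive_toggleGroup htrans hγ hcyc h₁
  have hact : ActsAsCycle {A : Finset E // A ∈ L} (⟨γ, hγ⟩ : toggleGroup L) := by
    refine ⟨?_, fun X Y hX hY => hcyc.exists_zpow_eq hX hY⟩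
    obtain ⟨X, hX, -⟩ := hcyc
    exact ⟨X, hX⟩
  have h4 := isMultiplyPretransitive_four_of_actsAsCycle hprim hact h₁ h₂ h₃ h12 h13 h23
  by_cases hL : ∀ e f, e ≠ f →
      (toggle L e * toggle L f) ^ 2 = 1 ∨ (toggle L e * toggle L f) ^ 3 = 1
  · obtain ⟨f⟩ : Nonempty E := by
      by_contra hE
      rw [not_nonempty_iff] at hE
      exact hcyc.ne_one (toggleGroup_induction (P := fun g => g = 1) rfl
        (fun e _ _ => isEmptyElim e) hγ)
    rw [Equiv.Perm.subgroup_eq_top_of_isPreprimitive_of_isSwap_mem hprim _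
      (isSwap_toggle htrans hcard hL (hnt f)) (toggle_mem f)]
    exact le_top
  · push Not at hL
    obtain ⟨e, f, -, h2, h3⟩ := hL
    have hmem : toggle L e * toggle L f ∈ toggleGroup L := mul_mem (toggle_mem e) (toggle_mem f)
    have hdisj : ((toggle L e * toggle L f) ^ 2).Disjoint ((toggle L e * toggle L f) ^ 3) :=
      toggle_pair_sq_or_cube e f
    have h6 : (toggle L e * toggle L f) ^ 6 = 1 := Equiv.ext fun X => by
      rcases toggle_pair_sq_or_cube e f X with h | h
      · rw [show 6 = 2 * 3 from rfl, pow_mul]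
        exact Equiv.Perm.pow_apply_eq_self_of_apply_eq_self h 3
      · rw [show 6 = 3 * 2 from rfl, pow_mul]
        exact Equiv.Perm.pow_apply_eq_self_of_apply_eq_self h 2
    refine alternatingGroup_le_of_disjoint_of_prime_pow (toggleGroup L)
      (by rw [Fintype.card_coe]; omega) (pow_mem hmem 2) (pow_mem hmem 3) Nat.prime_three
      Nat.prime_two (by decide) ?_ ?_ h2 h3 hdisj
    · rw [← pow_mul, h6]
    · rw [← pow_mul, h6]

end TogglePaper
end

section
/- Let E₁ and E₂ be disjoint finite ground sets, let 𝓛ᵢ be a collection of subsets of Eᵢ with |𝓛ᵢ| ≥ 2 for i = 1, 2, set ℓ = |𝓛₁|, m = |𝓛₂|, and let 𝓛 = 𝓛₁ ⊗ 𝓛₂ = {X₁ ∪ X₂ : X₁ ∈ 𝓛₁, X₂ ∈ 𝓛₂}. Then T(𝓛) contains a long cycle (a cycle of length |𝓛| = ℓm) if and only if gcd(ℓ, m) = 1 and both T(𝓛₁) and T(𝓛₂) contain long cycles (cycles of length ℓ and m on 𝓛₁ and 𝓛₂ respectively). -/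
open scoped symmDiff

namespace TogglePaper

variable {E : Type*} [DecidableEq E]

/-- A permutation of a finite type is transitive on it iff any point is reached from any other
by a natural power. -/
theorem isCycleOn_univ_iff {α : Type*} [Fintype α] (f : Equiv.Perm α) :
    f.IsCycleOn ((Finset.univ : Finset α) : Set α) ↔ ∀ x y, ∃ n : ℕ, (f ^ n) x = y := by
  constructor
  · intro h x y
    obtain ⟨n, -, hn⟩ := h.exists_pow_eq (Finset.mem_univ x) (Finset.mem_univ y)
    exact ⟨n, hn⟩
  · intro h
    refine ⟨by simp, fun x _ y _ => ?_⟩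
    obtain ⟨n, hn⟩ := h x y
    exact ⟨n, by simpa using hn⟩

/-- On a nontrivial finite type, a cycle with full support is the same as a transitive
permutation. -/
theorem isCycle_and_support_eq_univ_iff {α : Type*} [Fintype α] [DecidableEq α] [Nontrivial α]
    (f : Equiv.Perm α) :
    (f.IsCycle ∧ f.support = Finset.univ) ↔
      f.IsCycleOn ((Finset.univ : Finset α) : Set α) := by
  constructor
  · rintro ⟨hf, hs⟩
    rw [← hs, Equiv.Perm.coe_support_eq_set_support]
    exact hf.isCycleOn
  · intro h
    have hnt : ((Finset.univ : Finset α) : Set α).Nontrivial := by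
      simpa using ‹Nontrivial α›
    refine ⟨Equiv.Perm.isCycle_iff_exists_isCycleOn.2 ⟨_, hnt, h, fun x _ => by simp⟩, ?_⟩
    ext x
    simpa using h.apply_ne hnt (Finset.mem_coe.2 (Finset.mem_univ x))

theorem pow_apply_of_semiconj_prod {α β γ : Type*} (φ : α × β ≃ γ) {g : Equiv.Perm α}
    {h : Equiv.Perm β} {f : Equiv.Perm γ} (hf : ∀ a b, f (φ (a, b)) = φ (g a, h b)) (n : ℕ)
    (a : α) (b : β) : (f ^ n) (φ (a, b)) = φ ((g ^ n) a, (h ^ n) b) := by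
  induction n with
  | zero => simp
  | succ n ih => simp [pow_succ', ih, hf]

/-- A product permutation is transitive iff both factors are transitive and the cardinalities
of the factors are coprime. -/
theorem isCycleOn_univ_prod_iff {α β γ : Type*} [Fintype α] [Fintype β] [Fintype γ]
    [Nonempty α] [Nonempty β] (φ : α × β ≃ γ) {g : Equiv.Perm α} {h : Equiv.Perm β}
    {f : Equiv.Perm γ} (hf : ∀ a b, f (φ (a, b)) = φ (g a, h b)) :
    f.IsCycleOn ((Finset.univ : Finset γ) : Set γ) ↔
      Nat.Coprime (Fintype.card α) (Fintype.card β) ∧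
        g.IsCycleOn ((Finset.univ : Finset α) : Set α) ∧
        h.IsCycleOn ((Finset.univ : Finset β) : Set β) := by
  have hpow := pow_apply_of_semiconj_prod φ hf
  obtain ⟨a₀⟩ := ‹Nonempty α›
  obtain ⟨b₀⟩ := ‹Nonempty β›
  constructor
  · intro hc
    have hreach := (isCycleOn_univ_iff f).1 hc
    have hg : g.IsCycleOn ((Finset.univ : Finset α) : Set α) := by
      refine (isCycleOn_univ_iff g).2 fun x y => ?_
      obtain ⟨n, hn⟩ := hreach (φ (x, b₀)) (φ (y, b₀))
      rw [hpow] at hn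
      exact ⟨n, congrArg Prod.fst (φ.injective hn)⟩
    have hh : h.IsCycleOn ((Finset.univ : Finset β) : Set β) := by
      refine (isCycleOn_univ_iff h).2 fun x y => ?_
      obtain ⟨n, hn⟩ := hreach (φ (a₀, x)) (φ (a₀, y))
      rw [hpow] at hn
      exact ⟨n, congrArg Prod.snd (φ.injective hn)⟩
    refine ⟨?_, hg, hh⟩
    have hlcm : (f ^ Nat.lcm (Fintype.card α) (Fintype.card β)) (φ (a₀, b₀)) = φ (a₀, b₀) := by
      rw [hpow, (hg.pow_apply_eq (Finset.mem_univ a₀)).2 (Nat.dvd_lcm_left (Fintype.card α) _),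
        (hh.pow_apply_eq (Finset.mem_univ b₀)).2 (Nat.dvd_lcm_right _ (Fintype.card β))]
    have hdvd := (hc.pow_apply_eq (Finset.mem_univ _)).1 hlcm
    rw [Finset.card_univ, ← Fintype.card_congr φ, Fintype.card_prod] at hdvd
    have ha : 0 < Fintype.card α := Fintype.card_pos_iff.2 ⟨a₀⟩
    have hb : 0 < Fintype.card β := Fintype.card_pos_iff.2 ⟨b₀⟩
    have heq := Nat.dvd_antisymm hdvd
      (Nat.lcm_dvd (Nat.dvd_mul_right _ _) (Nat.dvd_mul_left _ _))
    rcases Nat.lcm_eq_mul_iff.1 heq.symm with h0 | h0 | h0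
    · omega
    · omega
    · exact h0
  · rintro ⟨hco, hg, hh⟩
    refine (isCycleOn_univ_iff f).2 fun x y => ?_
    obtain ⟨⟨a, b⟩, rfl⟩ := φ.surjective x
    obtain ⟨⟨c, d⟩, rfl⟩ := φ.surjective y
    obtain ⟨i, hi⟩ := (isCycleOn_univ_iff g).1 hg a c
    obtain ⟨j, hj⟩ := (isCycleOn_univ_iff h).1 hh b d
    obtain ⟨n, hni, hnj⟩ := Nat.chineseRemainder hco i j
    refine ⟨n, ?_⟩
    rw [hpow, (hg.pow_apply_eq_pow_apply (Finset.mem_univ a)).2 hni, hi,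
      (hh.pow_apply_eq_pow_apply (Finset.mem_univ b)).2 hnj, hj]

theorem hasLongCycle_iff {L : Finset (Finset E)} (hL : 2 ≤ L.card) :
    HasLongCycle L ↔ ∃ g ∈ toggleGroup L,
      g.IsCycleOn ((Finset.univ : Finset {A : Finset E // A ∈ L}) : Set _) := by
  have : Nontrivial {A : Finset E // A ∈ L} :=
    Fintype.one_lt_card_iff_nontrivial.1 (by simpa using! hL)
  simp only [HasLongCycle, isCycle_and_support_eq_univ_iff]

theorem coe_toggle_apply (L : Finset (Finset E)) (e : E) (X : {A : Finset E // A ∈ L}) :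
    (toggle L e X).1 = if X.1 ∆ {e} ∈ L then X.1 ∆ {e} else X.1 := by
  change (dite _ _ _ : {A : Finset E // A ∈ L}).1 = _
  split_ifs <;> rfl

theorem toggle_eq_one {L : Finset (Finset E)} {S : Finset E} (hS : ∀ X ∈ L, X ⊆ S) {e : E}
    (he : e ∉ S) : toggle L e = 1 := by
  ext1 X
  refine Subtype.ext ?_
  rw [coe_toggle_apply, if_neg]
  · rfl
  · intro h
    have heX : e ∉ X.1 := fun hX => he (hS _ X.2 hX)
    exact he (hS _ h (by simp [Finset.mem_symmDiff, heX]))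

section Product

variable {E₁ E₂ : Finset E} {L₁ L₂ L : Finset (Finset E)}

theorem union_inter_cancel_of_disjoint (hdisj : Disjoint E₁ E₂) {X Y : Finset E} (hX : X ⊆ E₁)
    (hY : Y ⊆ E₂) : (X ∪ Y) ∩ E₁ = X ∧ (X ∪ Y) ∩ E₂ = Y := by
  have hd := Finset.disjoint_left.1 hdisj
  constructor <;> ext x <;> have := @hX x <;> have := @hY x <;> have := @hd x <;>
    simp only [Finset.mem_inter, Finset.mem_union] <;> tauto

/-- The bijection `L₁ × L₂ ≃ L₁ ⊗ L₂` given by `(X₁, X₂) ↦ X₁ ∪ X₂`. -/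
noncomputable def unionEquiv (hdisj : Disjoint E₁ E₂)
    (hsub₁ : ∀ X ∈ L₁, X ⊆ E₁) (hsub₂ : ∀ X ∈ L₂, X ⊆ E₂)
    (hL : ∀ A : Finset E, A ∈ L ↔ ∃ X₁ ∈ L₁, ∃ X₂ ∈ L₂, A = X₁ ∪ X₂) :
    {A : Finset E // A ∈ L₁} × {A : Finset E // A ∈ L₂} ≃ {A : Finset E // A ∈ L} :=
  Equiv.ofBijective
    (fun p => ⟨p.1.1 ∪ p.2.1, (hL _).2 ⟨p.1.1, p.1.2, p.2.1, p.2.2, rfl⟩⟩) <| by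
    constructor
    · rintro ⟨⟨X, hX⟩, ⟨Y, hY⟩⟩ ⟨⟨X', hX'⟩, ⟨Y', hY'⟩⟩ h
      have h : X ∪ Y = X' ∪ Y' := congrArg Subtype.val h
      obtain ⟨h₁, h₂⟩ := union_inter_cancel_of_disjoint hdisj (hsub₁ X hX) (hsub₂ Y hY)
      obtain ⟨h₁', h₂'⟩ := union_inter_cancel_of_disjoint hdisj (hsub₁ X' hX') (hsub₂ Y' hY')
      rw [h] at h₁ h₂
      simp [← h₁, ← h₂, h₁', h₂']
    · rintro ⟨A, hA⟩
      obtain ⟨X, hX, Y, hY, rfl⟩ := (hL A).1 hA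
      exact ⟨(⟨X, hX⟩, ⟨Y, hY⟩), rfl⟩

variable (hdisj : Disjoint E₁ E₂) (hsub₁ : ∀ X ∈ L₁, X ⊆ E₁) (hsub₂ : ∀ X ∈ L₂, X ⊆ E₂)
  (hL : ∀ A : Finset E, A ∈ L ↔ ∃ X₁ ∈ L₁, ∃ X₂ ∈ L₂, A = X₁ ∪ X₂)

theorem coe_unionEquiv (X : {A : Finset E // A ∈ L₁}) (Y : {A : Finset E // A ∈ L₂}) :
    (unionEquiv hdisj hsub₁ hsub₂ hL (X, Y)).1 = X.1 ∪ Y.1 := rfl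

theorem union_symmDiff_singleton {X Y : Finset E} {e : E} (he : e ∉ Y) :
    (X ∪ Y) ∆ {e} = X ∆ {e} ∪ Y := by
  ext x
  by_cases hx : x = e
  · subst hx
    simp [Finset.mem_symmDiff, he]
  · simp [Finset.mem_symmDiff, hx]

theorem union_mem_iff (hdisj : Disjoint E₁ E₂)
    (hsub₁ : ∀ X ∈ L₁, X ⊆ E₁) (hsub₂ : ∀ X ∈ L₂, X ⊆ E₂)
    (hL : ∀ A : Finset E, A ∈ L ↔ ∃ X₁ ∈ L₁, ∃ X₂ ∈ L₂, A = X₁ ∪ X₂) {X Y : Finset E} (hX : X ⊆ E₁) (hY : Y ⊆ E₂) :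
    X ∪ Y ∈ L ↔ X ∈ L₁ ∧ Y ∈ L₂ := by
  rw [hL]
  constructor
  · rintro ⟨X', hX', Y', hY', h⟩
    obtain ⟨h₁, h₂⟩ := union_inter_cancel_of_disjoint hdisj hX hY
    obtain ⟨h₁', h₂'⟩ := union_inter_cancel_of_disjoint hdisj (hsub₁ X' hX') (hsub₂ Y' hY')
    rw [h] at h₁ h₂
    rw [← h₁, ← h₂, h₁', h₂']
    exact ⟨hX', hY'⟩
  · rintro ⟨hX, hY⟩
    exact ⟨X, hX, Y, hY, rfl⟩

theorem symmDiff_singleton_subset {X S : Finset E} {e : E} (hX : X ⊆ S) (he : e ∈ S) :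
    X ∆ {e} ⊆ S := by
  intro x hx
  rcases Finset.mem_symmDiff.1 hx with h | h
  · exact hX h.1
  · rwa [Finset.mem_singleton.1 h.1]

theorem toggle_unionEquiv (e : E) (X : {A : Finset E // A ∈ L₁})
    (Y : {A : Finset E // A ∈ L₂}) :
    toggle L e (unionEquiv hdisj hsub₁ hsub₂ hL (X, Y)) =
      unionEquiv hdisj hsub₁ hsub₂ hL (toggle L₁ e X, toggle L₂ e Y) := by
  have hX := hsub₁ _ X.2
  have hY := hsub₂ _ Y.2
  by_cases h₁ : e ∈ E₁
  · have h₂ : e ∉ E₂ := Finset.disjoint_left.1 hdisj h₁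
    rw [toggle_eq_one hsub₂ h₂]
    refine Subtype.ext ?_
    rw [coe_toggle_apply, coe_unionEquiv, coe_unionEquiv, coe_toggle_apply,
      union_symmDiff_singleton fun h => h₂ (hY h)]
    simp only [union_mem_iff hdisj hsub₁ hsub₂ hL (symmDiff_singleton_subset hX h₁) hY,
      Y.2, and_true, Equiv.Perm.coe_one, id]
    split_ifs <;> rfl
  by_cases h₂ : e ∈ E₂
  · rw [toggle_eq_one hsub₁ h₁]
    refine Subtype.ext ?_
    rw [coe_toggle_apply, coe_unionEquiv, coe_unionEquiv, coe_toggle_apply,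
      Finset.union_comm X.1, union_symmDiff_singleton fun h => h₁ (hX h),
      Finset.union_comm _ X.1,
      Finset.union_comm Y.1]
    simp only [union_mem_iff hdisj hsub₁ hsub₂ hL hX (symmDiff_singleton_subset hY h₂),
      X.2, true_and, Equiv.Perm.coe_one, id]
    split_ifs <;> rfl
  · have hsub : ∀ A ∈ L, A ⊆ E₁ ∪ E₂ := by
      intro A hA
      obtain ⟨X, hX, Y, hY, rfl⟩ := (hL A).1 hA
      exact Finset.union_subset_union (hsub₁ X hX) (hsub₂ Y hY)
    rw [toggle_eq_one hsub₁ h₁, toggle_eq_one hsub₂ h₂, toggle_eq_one hsub (by simp [h₁, h₂])]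
    rfl

/-- Every element of `T(L₁ ⊗ L₂)` acts as a pair of elements of `T(L₁)` and `T(L₂)`. -/
theorem exists_semiconj_of_mem_toggleGroup {f : Equiv.Perm {A : Finset E // A ∈ L}}
    (hf : f ∈ toggleGroup L) :
    ∃ g ∈ toggleGroup L₁, ∃ h ∈ toggleGroup L₂, ∀ X Y,
      f (unionEquiv hdisj hsub₁ hsub₂ hL (X, Y)) =
        unionEquiv hdisj hsub₁ hsub₂ hL (g X, h Y) := by
  induction hf using Subgroup.closure_induction with
  | mem f hf =>
    obtain ⟨e, rfl⟩ := hf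
    exact ⟨_, Subgroup.subset_closure ⟨e, rfl⟩, _, Subgroup.subset_closure ⟨e, rfl⟩,
      toggle_unionEquiv hdisj hsub₁ hsub₂ hL e⟩
  | one => exact ⟨1, one_mem _, 1, one_mem _, fun _ _ => rfl⟩
  | mul f f' _ _ ih ih' =>
    obtain ⟨g, hg, h, hh, H⟩ := ih
    obtain ⟨g', hg', h', hh', H'⟩ := ih'
    exact ⟨g * g', mul_mem hg hg', h * h', mul_mem hh hh', fun X Y => by simp [H, H']⟩
  | inv f _ ih =>
    obtain ⟨g, hg, h, hh, H⟩ := ih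
    exact ⟨g⁻¹, inv_mem hg, h⁻¹, inv_mem hh, fun X Y => by
      rw [Equiv.Perm.inv_eq_iff_eq, H]; simp⟩

/-- Every pair of elements of `T(L₁)` and `T(L₂)` is induced by an element of `T(L₁ ⊗ L₂)`. -/
theorem exists_mem_toggleGroup_semiconj {g : Equiv.Perm {A : Finset E // A ∈ L₁}}
    (hg : g ∈ toggleGroup L₁) {h : Equiv.Perm {A : Finset E // A ∈ L₂}}
    (hh : h ∈ toggleGroup L₂) :
    ∃ f ∈ toggleGroup L, ∀ X Y,
      f (unionEquiv hdisj hsub₁ hsub₂ hL (X, Y)) =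
        unionEquiv hdisj hsub₁ hsub₂ hL (g X, h Y) := by
  set φ := unionEquiv hdisj hsub₁ hsub₂ hL
  let Φ : Equiv.Perm {A : Finset E // A ∈ L₁} × Equiv.Perm {A : Finset E // A ∈ L₂} →*
      Equiv.Perm {A : Finset E // A ∈ L} :=
    { toFun := fun p => φ.permCongr (Equiv.prodCongr p.1 p.2)
      map_one' := by ext1; simp
      map_mul' := fun _ _ => by ext1; simp [Prod.map] }
  have hΦ : ∀ g h X Y, Φ (g, h) (φ (X, Y)) = φ (g X, h Y) := fun g h X Y => by
    simp [Φ]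
  have hΦ_toggle : ∀ e, Φ (toggle L₁ e, toggle L₂ e) = toggle L e := fun e => by
    ext1 A
    obtain ⟨⟨X, Y⟩, rfl⟩ := φ.surjective A
    rw [hΦ, toggle_unionEquiv hdisj hsub₁ hsub₂ hL]
  have hmem : ∀ e, Φ (toggle L₁ e, toggle L₂ e) ∈ toggleGroup L := fun e =>
    hΦ_toggle e ▸ Subgroup.subset_closure ⟨e, rfl⟩
  have hle₁ : toggleGroup L₁ ≤ (toggleGroup L).comap (Φ.comp (MonoidHom.inl _ _)) := by
    refine (Subgroup.closure_le _).2 ?_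
    rintro _ ⟨e, rfl⟩
    change Φ (toggle L₁ e, 1) ∈ toggleGroup L
    by_cases he : e ∈ E₁
    · exact toggle_eq_one hsub₂ (Finset.disjoint_left.1 hdisj he) ▸ hmem e
    · rw [toggle_eq_one hsub₁ he, ← Prod.one_eq_mk, map_one]
      exact one_mem _
  have hle₂ : toggleGroup L₂ ≤ (toggleGroup L).comap (Φ.comp (MonoidHom.inr _ _)) := by
    refine (Subgroup.closure_le _).2 ?_
    rintro _ ⟨e, rfl⟩
    change Φ (1, toggle L₂ e) ∈ toggleGroup L
    by_cases he : e ∈ E₂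
    · exact toggle_eq_one hsub₁ (Finset.disjoint_right.1 hdisj he) ▸ hmem e
    · rw [toggle_eq_one hsub₂ he, ← Prod.one_eq_mk, map_one]
      exact one_mem _
  refine ⟨Φ (g, 1) * Φ (1, h), mul_mem (hle₁ hg) (hle₂ hh), fun X Y => ?_⟩
  rw [Equiv.Perm.mul_apply, hΦ, hΦ, Equiv.Perm.one_apply, Equiv.Perm.one_apply]

end Product

/-- for a toggle-disjoint Cartesian product `L = L₁ ⊗ L₂` with
`|Lᵢ| ≥ 2`, the group `T(L)` contains a long cycle iff `gcd(|L₁|, |L₂|) = 1` and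
both `T(L₁)` and `T(L₂)` contain long cycles. -/
theorem cartesian_product_long_cycle_iff
    [Fintype E]
    (E₁ E₂ : Finset E) (hdisj : Disjoint E₁ E₂)
    (L₁ L₂ : Finset (Finset E))
    (hsub₁ : ∀ X ∈ L₁, X ⊆ E₁) (hsub₂ : ∀ X ∈ L₂, X ⊆ E₂)
    (hcard₁ : 2 ≤ L₁.card) (hcard₂ : 2 ≤ L₂.card)
    (L : Finset (Finset E))
    (hL : ∀ A : Finset E, A ∈ L ↔ ∃ X₁ ∈ L₁, ∃ X₂ ∈ L₂, A = X₁ ∪ X₂) :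
    HasLongCycle L ↔
      Nat.Coprime L₁.card L₂.card ∧ HasLongCycle L₁ ∧ HasLongCycle L₂ := by
  have hne₁ : Nonempty {A : Finset E // A ∈ L₁} :=
    (Finset.card_pos.1 (by omega : 0 < L₁.card)).to_subtype
  have hne₂ : Nonempty {A : Finset E // A ∈ L₂} :=
    (Finset.card_pos.1 (by omega : 0 < L₂.card)).to_subtype
  have hcard : L.card = L₁.card * L₂.card := by
    simpa using (Fintype.card_congr (unionEquiv hdisj hsub₁ hsub₂ hL)).symm
  rw [hasLongCycle_iff hcard₁, hasLongCycle_iff hcard₂, hasLongCycle_iff (by nlinarith)]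
  constructor
  · rintro ⟨f, hf, hc⟩
    obtain ⟨g, hg, h, hh, H⟩ :=
      exists_semiconj_of_mem_toggleGroup hdisj hsub₁ hsub₂ hL hf
    obtain ⟨hco, hcg, hch⟩ := (isCycleOn_univ_prod_iff _ H).1 hc
    exact ⟨by simpa using hco, ⟨g, hg, hcg⟩, ⟨h, hh, hch⟩⟩
  · rintro ⟨hco, ⟨g, hg, hcg⟩, ⟨h, hh, hch⟩⟩
    obtain ⟨f, hf, H⟩ := exists_mem_toggleGroup_semiconj hdisj hsub₁ hsub₂ hL hg hh
    exact ⟨f, hf, (isCycleOn_univ_prod_iff _ H).2 ⟨by simpa using hco, hcg, hch⟩⟩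

end TogglePaper
end
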